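/- (1) If 0 → C → D → Q → 0 is an exact sequence in Fun(BG, ∗Cat^nu_ℂ), then 0 → C⋊^alg G → D⋊^alg G → Q⋊^alg G → 0 is an exact sequence in ∗Cat^nu_ℂ. (2) If 0 → C → D → Q → 0 is an exact sequence of C*-categories in Fun(BG, C*Cat^nu) such that D is unital, then 0 → C⋊G → D⋊G → Q⋊G → 0 is an exact sequence of C*-categories. -/

import Mathlib

noncomputable section

open scoped ENNReal

/-- A possibly non-unital ℂ-linear ∗-category. -/
structure StarCatNu : Type 1 where
  Obj : Type
  Hom : Obj → Obj → Type
  [homAddCommGroup : ∀ X Y, AddCommGroup (Hom X Y)]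
  [homModule : ∀ X Y, Module ℂ (Hom X Y)]
  comp : ∀ {X Y Z : Obj}, Hom Y Z → Hom X Y → Hom X Z
  star : ∀ {X Y : Obj}, Hom X Y → Hom Y X
  comp_assoc : ∀ {W X Y Z : Obj} (h : Hom Y Z) (g : Hom X Y) (f : Hom W X),
    comp (comp h g) f = comp h (comp g f)
  add_comp : ∀ {X Y Z : Obj} (g g' : Hom Y Z) (f : Hom X Y),
    comp (g + g') f = comp g f + comp g' f
  comp_add : ∀ {X Y Z : Obj} (g : Hom Y Z) (f f' : Hom X Y),
    comp g (f + f') = comp g f + comp g f'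
  smul_comp : ∀ {X Y Z : Obj} (c : ℂ) (g : Hom Y Z) (f : Hom X Y),
    comp (c • g) f = c • comp g f
  comp_smul : ∀ {X Y Z : Obj} (c : ℂ) (g : Hom Y Z) (f : Hom X Y),
    comp g (c • f) = c • comp g f
  star_star : ∀ {X Y : Obj} (f : Hom X Y), star (star f) = f
  star_comp : ∀ {X Y Z : Obj} (g : Hom Y Z) (f : Hom X Y),
    star (comp g f) = comp (star f) (star g)
  star_add : ∀ {X Y : Obj} (f f' : Hom X Y), star (f + f') = star f + star f'
  star_smul : ∀ {X Y : Obj} (c : ℂ) (f : Hom X Y),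
    star (c • f) = (starRingEnd ℂ) c • star f

attribute [instance] StarCatNu.homAddCommGroup StarCatNu.homModule

namespace StarCatNu

/-- Transport of morphisms along equalities of objects. -/
def castHom (C : StarCatNu) {X X' Y Y' : C.Obj} (hX : X = X') (hY : Y = Y')
    (f : C.Hom X Y) : C.Hom X' Y' := hX ▸ hY ▸ f

theorem comp_zero (C : StarCatNu) {X Y Z : C.Obj} (g : C.Hom Y Z) :
    C.comp g (0 : C.Hom X Y) = 0 :=
  (AddMonoidHom.mk' (fun f : C.Hom X Y => C.comp g f) (C.comp_add g)).map_zero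

theorem zero_comp (C : StarCatNu) {X Y Z : C.Obj} (f : C.Hom X Y) :
    C.comp (0 : C.Hom Y Z) f = 0 :=
  (AddMonoidHom.mk' (fun g : C.Hom Y Z => C.comp g f) (fun a b => C.add_comp a b f)).map_zero

theorem star_zero' (C : StarCatNu) {X Y : C.Obj} :
    C.star (0 : C.Hom X Y) = 0 :=
  (AddMonoidHom.mk' (fun f : C.Hom X Y => C.star f) C.star_add).map_zero

end StarCatNu

/-- A (not necessarily unit-preserving) functor between possibly non-unital ℂ-linear
∗-categories, compatible with the enrichment and the involutions. -/
structure StarFunctor (C D : StarCatNu) where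
  obj : C.Obj → D.Obj
  map : ∀ {X Y : C.Obj}, C.Hom X Y → D.Hom (obj X) (obj Y)
  map_add : ∀ (X Y : C.Obj) (f f' : C.Hom X Y), map (f + f') = map f + map f'
  map_smul : ∀ (X Y : C.Obj) (c : ℂ) (f : C.Hom X Y), map (c • f) = c • map f
  map_comp : ∀ (X Y Z : C.Obj) (g : C.Hom Y Z) (f : C.Hom X Y),
    map (C.comp g f) = D.comp (map g) (map f)
  map_star : ∀ (X Y : C.Obj) (f : C.Hom X Y), map (C.star f) = D.star (map f)

namespace StarFunctor

theorem map_zero {C D : StarCatNu} (F : StarFunctor C D) (X Y : C.Obj) :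
    F.map (0 : C.Hom X Y) = 0 :=
  (AddMonoidHom.mk' (fun f : C.Hom X Y => F.map f) (F.map_add X Y)).map_zero

/-- The identity functor. -/
def id (C : StarCatNu) : StarFunctor C C where
  obj X := X
  map f := f
  map_add _ _ _ _ := rfl
  map_smul _ _ _ _ := rfl
  map_comp _ _ _ _ _ := rfl
  map_star _ _ _ := rfl

/-- Composition of functors: first `F`, then `G`. -/
def comp {C D E : StarCatNu} (F : StarFunctor C D) (G : StarFunctor D E) :
    StarFunctor C E where
  obj X := G.obj (F.obj X)
  map f := G.map (F.map f)
  map_add X Y f f' := by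
    show G.map (F.map (f + f')) = G.map (F.map f) + G.map (F.map f')
    rw [F.map_add, G.map_add]
  map_smul X Y c f := by
    show G.map (F.map (c • f)) = c • G.map (F.map f)
    rw [F.map_smul, G.map_smul]
  map_comp X Y Z g f := by
    show G.map (F.map (C.comp g f)) = E.comp (G.map (F.map g)) (G.map (F.map f))
    rw [F.map_comp, G.map_comp]
  map_star X Y f := by
    show G.map (F.map (C.star f)) = E.star (G.map (F.map f))
    rw [F.map_star, G.map_star]

end StarFunctor

instance : CategoryTheory.Category StarCatNu where
  Hom := StarFunctor
  id := StarFunctor.id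
  comp := StarFunctor.comp
  id_comp := by intros; rfl
  comp_id := by intros; rfl
  assoc := by intros; rfl
/-- A possibly non-unital ∗-algebra over ℂ regarded as a ℂ-linear ∗-category with a
single object. -/
def StarCatNu.ofAlgebra (B : Type) [NonUnitalRing B] [Module ℂ B]
    [SMulCommClass ℂ B B] [IsScalarTower ℂ B B] [StarRing B] [StarModule ℂ B] :
    StarCatNu where
  Obj := PUnit
  Hom _ _ := B
  comp g f := g * f
  star b := Star.star b
  comp_assoc h g f := mul_assoc h g f
  add_comp g g' f := add_mul g g' f
  comp_add g f f' := mul_add g f f'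
  smul_comp c g f := smul_mul_assoc c g f
  comp_smul c g f := mul_smul_comm c g f
  star_star f := InvolutiveStar.star_involutive f
  star_comp g f := StarMul.star_mul g f
  star_add f f' := StarAddMonoid.star_add f f'
  star_smul c f := by
    show Star.star (c • f) = (starRingEnd ℂ) c • Star.star f
    rw [StarModule.star_smul, starRingEnd_apply]

/-- The maximal semi-norm of a morphism in a possibly non-unital ℂ-linear ∗-category:
the supremum of `‖ρ f‖` over all morphisms `ρ` into C*-algebras regarded as one-object
ℂ-linear ∗-categories. -/
noncomputable def StarCatNu.repNorm (C : StarCatNu) {X Y : C.Obj} (f : C.Hom X Y)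
    (B : Type) [NonUnitalCStarAlgebra B] (ρ : StarFunctor C (StarCatNu.ofAlgebra B)) : ℝ≥0∞ :=
  (‖id (α := B) (ρ.map f)‖₊ : ℝ≥0∞)

noncomputable def StarCatNu.maxNorm (C : StarCatNu) {X Y : C.Obj} (f : C.Hom X Y) : ℝ≥0∞ :=
  sSup { r : ℝ≥0∞ | ∃ (B : Type) (i : NonUnitalCStarAlgebra B)
    (ρ : StarFunctor C (StarCatNu.ofAlgebra B)), r = @StarCatNu.repNorm C X Y f B i ρ }

/-- A pre-C*-category: all morphisms have finite maximal semi-norm. -/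
def IsPreCStar (C : StarCatNu) : Prop :=
  ∀ (X Y : C.Obj) (f : C.Hom X Y), C.maxNorm f < ⊤

/-- A C*-category: the maximal semi-norm is a finite norm and the morphism spaces are
complete with respect to it (completeness is expressed via Cauchy sequences). -/
def IsCStar (C : StarCatNu) : Prop :=
  IsPreCStar C ∧
  (∀ (X Y : C.Obj) (f : C.Hom X Y), C.maxNorm f = 0 → f = 0) ∧
  (∀ (X Y : C.Obj) (u : ℕ → C.Hom X Y),
    (∀ ε : ℝ≥0∞, 0 < ε → ∃ N, ∀ m ≥ N, ∀ n ≥ N, C.maxNorm (u m - u n) < ε) →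
    ∃ f : C.Hom X Y, ∀ ε : ℝ≥0∞, 0 < ε → ∃ N, ∀ n ≥ N, C.maxNorm (u n - f) < ε)

/-- `e` is an identity morphism at its object. -/
def IsIdentityAt (C : StarCatNu) {X : C.Obj} (e : C.Hom X X) : Prop :=
  (∀ (Y : C.Obj) (f : C.Hom X Y), C.comp f e = f) ∧
  (∀ (Y : C.Obj) (g : C.Hom Y X), C.comp e g = g)

/-- A ℂ-linear ∗-category is unital if every object admits an identity morphism. -/
def StarCatNu.IsUnital (C : StarCatNu) : Prop :=
  ∀ X : C.Obj, ∃ e : C.Hom X X, IsIdentityAt C e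

/-- A functor is unital if it sends identity morphisms to identity morphisms. -/
def StarFunctor.Unital {C D : StarCatNu} (F : StarFunctor C D) : Prop :=
  ∀ (X : C.Obj) (e : C.Hom X X), IsIdentityAt C e → IsIdentityAt D (F.map e)

/-- A morphism `u` is unitary if `u* ∘ u` and `u ∘ u*` are identity morphisms. -/
def IsUnitary (D : StarCatNu) {A B : D.Obj} (u : D.Hom A B) : Prop :=
  IsIdentityAt D (D.comp (D.star u) u) ∧ IsIdentityAt D (D.comp u (D.star u))

/-- A unitary natural transformation between two functors. -/
structure UnitaryTrans {C D : StarCatNu} (F G : StarFunctor C D) where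
  app : ∀ X : C.Obj, D.Hom (F.obj X) (G.obj X)
  natural : ∀ (X Y : C.Obj) (f : C.Hom X Y),
    D.comp (app Y) (F.map f) = D.comp (G.map f) (app X)
  unitary : ∀ X : C.Obj, IsUnitary D (app X)

/-- A functor is a unitary equivalence if it is invertible up to unitary isomorphism. -/
def IsUnitaryEquiv {C D : StarCatNu} (F : StarFunctor C D) : Prop :=
  ∃ H : StarFunctor D C,
    Nonempty (UnitaryTrans (F.comp H) (StarFunctor.id C)) ∧
    Nonempty (UnitaryTrans (H.comp F) (StarFunctor.id D))

/-- A quotient morphism: bijective on objects and surjective on all morphism spaces. -/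
def IsQuotientHom {C D : StarCatNu} (F : StarFunctor C D) : Prop :=
  Function.Bijective F.obj ∧
  ∀ (X Y : C.Obj), Function.Surjective (fun f : C.Hom X Y => F.map f)

/-- An exact sequence `0 → C → D → Q → 0`: `p` is a quotient morphism and `i` is the
inclusion of its kernel. -/
structure IsExactSeq {C D Q : StarCatNu} (i : StarFunctor C D) (p : StarFunctor D Q) : Prop where
  i_obj_bij : Function.Bijective i.obj
  i_map_inj : ∀ (X Y : C.Obj), Function.Injective (fun f : C.Hom X Y => i.map f)
  p_quot : IsQuotientHom p
  exact : ∀ (X Y : C.Obj) (f : D.Hom (i.obj X) (i.obj Y)),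
    p.map f = 0 ↔ ∃ g : C.Hom X Y, i.map g = f

/-- `ι : C → Cc` exhibits the C*-category `Cc` as the completion of the pre-C*-category `C`
with respect to the maximal semi-norm. -/
structure IsCompletion (C Cc : StarCatNu) (ι : StarFunctor C Cc) : Prop where
  pre : IsPreCStar C
  cstar : IsCStar Cc
  obj_bij : Function.Bijective ι.obj
  isometric : ∀ (X Y : C.Obj) (f : C.Hom X Y), Cc.maxNorm (ι.map f) = C.maxNorm f
  dense : ∀ (X Y : C.Obj) (h : Cc.Hom (ι.obj X) (ι.obj Y)) (ε : ℝ≥0∞), 0 < ε →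
    ∃ f : C.Hom X Y, Cc.maxNorm (h - ι.map f) < ε
/-- An action of a group `G` on a possibly non-unital ℂ-linear ∗-category `C` by
automorphisms (an object of `Fun(BG, ∗Cat^nu_ℂ)`). -/
structure GAction (G : Type) [Group G] (C : StarCatNu) where
  actObj : G → C.Obj → C.Obj
  actMap : ∀ (g : G) {X Y : C.Obj}, C.Hom X Y → C.Hom (actObj g X) (actObj g Y)
  one_obj : ∀ X : C.Obj, actObj 1 X = X
  mul_obj : ∀ (g h : G) (X : C.Obj), actObj g (actObj h X) = actObj (g * h) X
  one_map : ∀ (X Y : C.Obj) (f : C.Hom X Y),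
    C.castHom (one_obj X) (one_obj Y) (actMap 1 f) = f
  mul_map : ∀ (g h : G) (X Y : C.Obj) (f : C.Hom X Y),
    C.castHom (mul_obj g h X) (mul_obj g h Y) (actMap g (actMap h f)) = actMap (g * h) f
  map_add : ∀ (g : G) (X Y : C.Obj) (f f' : C.Hom X Y),
    actMap g (f + f') = actMap g f + actMap g f'
  map_smul : ∀ (g : G) (X Y : C.Obj) (c : ℂ) (f : C.Hom X Y),
    actMap g (c • f) = c • actMap g f
  map_comp : ∀ (g : G) (X Y Z : C.Obj) (u : C.Hom Y Z) (f : C.Hom X Y),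
    actMap g (C.comp u f) = C.comp (actMap g u) (actMap g f)
  map_star : ∀ (g : G) (X Y : C.Obj) (f : C.Hom X Y),
    actMap g (C.star f) = C.star (actMap g f)

namespace GAction

variable {G : Type} [Group G] {C : StarCatNu}

/-- The automorphism of `C` given by the action of `g`. -/
def functor (α : GAction G C) (g : G) : StarFunctor C C where
  obj := α.actObj g
  map := α.actMap g
  map_add := α.map_add g
  map_smul := α.map_smul g
  map_comp := α.map_comp g
  map_star := α.map_star g

theorem inv_mul_obj (α : GAction G C) (g g' : G) (Z : C.Obj) :
    α.actObj g⁻¹ (α.actObj g'⁻¹ Z) = α.actObj (g' * g)⁻¹ Z := by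
  rw [α.mul_obj, mul_inv_rev]

theorem cancel_obj (α : GAction G C) (g : G) (Y : C.Obj) :
    α.actObj g (α.actObj g⁻¹ Y) = Y := by
  rw [α.mul_obj, mul_inv_cancel, α.one_obj]

theorem inv_inv_obj (α : GAction G C) (g : G) (X : C.Obj) :
    α.actObj g⁻¹⁻¹ X = α.actObj g X := by rw [inv_inv]

theorem one_inv_obj (α : GAction G C) (Y : C.Obj) :
    α.actObj (1 : G)⁻¹ Y = Y := by rw [inv_one, α.one_obj]

theorem lc_obj (α : GAction G C) (a b : G) (Y : C.Obj) :
    α.actObj a⁻¹ Y = α.actObj (b⁻¹ * a)⁻¹ (α.actObj b⁻¹ Y) := by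
  rw [α.mul_obj]
  congr 1
  group

end GAction

/-- `CG` together with the data `obj`, `ins` is a realization of the algebraic crossed
product `C ⋊^alg G`: its objects are those of `C`, its morphism spaces are the direct sums
`⊕_{g ∈ G} Hom_C(X, g⁻¹Y)` (the element of the `g`-th summand corresponding to `f` being
`ins g f`, i.e. `(f, g)`), with composition `(f', g') ∘ (f, g) = (g⁻¹f' ∘ f, g'g)` and
involution `(f, g)* = (g f*, g⁻¹)`. -/
structure IsCrossedProductAlg (G : Type) [Group G] (C : StarCatNu) (α : GAction G C)
    (CG : StarCatNu) where
  obj : C.Obj → CG.Obj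
  obj_bij : Function.Bijective obj
  ins : ∀ (g : G) {X Y : C.Obj}, C.Hom X (α.actObj g⁻¹ Y) → CG.Hom (obj X) (obj Y)
  ins_add : ∀ (g : G) (X Y : C.Obj) (f f' : C.Hom X (α.actObj g⁻¹ Y)),
    ins g (f + f') = ins g f + ins g f'
  ins_smul : ∀ (g : G) (X Y : C.Obj) (c : ℂ) (f : C.Hom X (α.actObj g⁻¹ Y)),
    ins g (c • f) = c • ins g f
  ins_comp : ∀ (g g' : G) (X Y Z : C.Obj)
    (f : C.Hom X (α.actObj g⁻¹ Y)) (f' : C.Hom Y (α.actObj g'⁻¹ Z)),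
    CG.comp (ins g' f') (ins g f) =
      ins (g' * g) (C.castHom rfl (α.inv_mul_obj g g' Z)
        (C.comp (α.actMap g⁻¹ f') f))
  ins_star : ∀ (g : G) (X Y : C.Obj) (f : C.Hom X (α.actObj g⁻¹ Y)),
    CG.star (ins g f) =
      ins g⁻¹ (C.castHom (α.cancel_obj g Y) (α.inv_inv_obj g X).symm
        (α.actMap g (C.star f)))
  span : ∀ (X Y : C.Obj) (u : CG.Hom (obj X) (obj Y)),
    ∃ (s : Finset G) (φ : ∀ g : G, C.Hom X (α.actObj g⁻¹ Y)),
      u = s.sum fun g => ins g (φ g)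
  indep : ∀ (X Y : C.Obj) (s : Finset G) (φ : ∀ g : G, C.Hom X (α.actObj g⁻¹ Y)),
    (s.sum fun g => ins g (φ g)) = 0 → ∀ g ∈ s, φ g = 0

/-- A (strictly) equivariant morphism between ℂ-linear ∗-categories with `G`-action,
i.e. a morphism in `Fun(BG, ∗Cat^nu_ℂ)`. -/
structure EquivariantMap {G : Type} [Group G] {C D : StarCatNu}
    (α : GAction G C) (β : GAction G D) (φ : StarFunctor C D) : Prop where
  obj_comm : ∀ (g : G) (X : C.Obj), φ.obj (α.actObj g X) = β.actObj g (φ.obj X)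
  map_comm : ∀ (g : G) (X Y : C.Obj) (f : C.Hom X Y),
    D.castHom (obj_comm g X) (obj_comm g Y) (φ.map (α.actMap g f)) =
      β.actMap g (φ.map f)

/-- The morphism `φ ⋊^alg G : C ⋊^alg G → D ⋊^alg G` induced by an equivariant morphism
`φ : C → D`: it acts like `φ` on objects and sends `(f, g)` to `(φ(f), g)`. -/
structure IsCrossedMap {G : Type} [Group G] {C D : StarCatNu}
    (α : GAction G C) (β : GAction G D) (φ : StarFunctor C D)
    (hφ : EquivariantMap α β φ) {CG DG : StarCatNu}
    (hC : IsCrossedProductAlg G C α CG) (hD : IsCrossedProductAlg G D β DG)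
    (ψ : StarFunctor CG DG) : Prop where
  obj_eq : ∀ X : C.Obj, ψ.obj (hC.obj X) = hD.obj (φ.obj X)
  map_eq : ∀ (g : G) (X Y : C.Obj) (f : C.Hom X (α.actObj g⁻¹ Y)),
    DG.castHom (obj_eq X) (obj_eq Y) (ψ.map (hC.ins g f)) =
      hD.ins g (D.castHom rfl (hφ.obj_comm g⁻¹ Y) (φ.map f))

/-- The morphism `φ ⋊ G : C ⋊ G → D ⋊ G` of completed crossed products induced by an
equivariant morphism `φ : C → D` of C*-categories with `G`-action. -/
structure IsCrossedMapC {G : Type} [Group G] {C D : StarCatNu}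
    (α : GAction G C) (β : GAction G D) (φ : StarFunctor C D)
    (hφ : EquivariantMap α β φ) {CG DG CGc DGc : StarCatNu}
    (hC : IsCrossedProductAlg G C α CG) (hD : IsCrossedProductAlg G D β DG)
    (κC : StarFunctor CG CGc) (κD : StarFunctor DG DGc)
    (ψ : StarFunctor CGc DGc) : Prop where
  obj_eq : ∀ X : C.Obj, ψ.obj (κC.obj (hC.obj X)) = κD.obj (hD.obj (φ.obj X))
  map_eq : ∀ (g : G) (X Y : C.Obj) (f : C.Hom X (α.actObj g⁻¹ Y)),
    DGc.castHom (obj_eq X) (obj_eq Y) (ψ.map (κC.map (hC.ins g f))) =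
      κD.map (hD.ins g (D.castHom rfl (hφ.obj_comm g⁻¹ Y) (φ.map f)))

open scoped ENNReal InnerProductSpace

/-- The value of a representation, as an element of the algebra. -/
def StarFunctor.rv {C : StarCatNu} {B : Type} [NonUnitalCStarAlgebra B]
    (ρ : StarFunctor C (StarCatNu.ofAlgebra B)) {X Y : C.Obj} (f : C.Hom X Y) : B := ρ.map f

section compl
open UniformSpace
variable {V W U : Type} [SeminormedAddCommGroup V] [InnerProductSpace ℂ V]
  [SeminormedAddCommGroup W] [InnerProductSpace ℂ W]
  [SeminormedAddCommGroup U] [InnerProductSpace ℂ U]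

theorem cadd (a b : V →L[ℂ] W) :
    (a + b).completion = a.completion + b.completion := by
  ext x
  induction x using Completion.induction_on with
  | hp => exact isClosed_eq (ContinuousLinearMap.continuous _) (ContinuousLinearMap.continuous _)
  | ih x =>
    rw [add_apply]
    simp only [ContinuousLinearMap.completion_apply_coe, add_apply]
    exact Completion.coe_add _ _

theorem csmul (c : ℂ) (b : V →L[ℂ] W) :
    (c • b).completion = c • b.completion := by
  ext x
  induction x using Completion.induction_on with
  | hp => exact isClosed_eq (ContinuousLinearMap.continuous _) (ContinuousLinearMap.continuous _)
  | ih x =>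
    rw [smul_apply]
    simp only [ContinuousLinearMap.completion_apply_coe, smul_apply]
    exact Completion.coe_smul _ _

theorem ccomp (a : V →L[ℂ] W) (b : U →L[ℂ] V) :
    (a ∘L b).completion = a.completion ∘L b.completion := by
  ext x
  induction x using Completion.induction_on with
  | hp => exact isClosed_eq (ContinuousLinearMap.continuous _) (ContinuousLinearMap.continuous _)
  | ih x =>
    simp only [ContinuousLinearMap.completion_apply_coe, ContinuousLinearMap.comp_apply]
end compl

section gns
open UniformSpace

variable {ι : Type} (V : ι → Type) [∀ Y, SeminormedAddCommGroup (V Y)]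
  [∀ Y, InnerProductSpace ℂ (V Y)]

abbrev GnsH : Type := lp (fun Y : ι => Completion (V Y)) 2

open Classical in
def gnsS (Y : ι) : Completion (V Y) →L[ℂ] GnsH V :=
  LinearMap.mkContinuous (lp.lsingle (𝕜 := ℂ) (E := fun Y : ι => Completion (V Y)) 2 Y) 1 (by
    intro x
    rw [one_mul]
    exact (lp.norm_single (p := 2) (E := fun Y : ι => Completion (V Y)) (by norm_num) Y x).le)

open Classical in
theorem gnsS_norm (Y : ι) (x : Completion (V Y)) : ‖gnsS V Y x‖ = ‖x‖ :=
  lp.norm_single (p := 2) (E := fun Y : ι => Completion (V Y)) (by norm_num) Y x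

theorem gnsS_adj (Y : ι) : (ContinuousLinearMap.adjoint (gnsS V Y)) ∘L (gnsS V Y) = 1 := by
  rw [← ContinuousLinearMap.norm_map_iff_adjoint_comp_self]
  exact gnsS_norm V Y

theorem gns1 (E : StarCatNu) (V : E.Obj → Type) [∀ Y, SeminormedAddCommGroup (V Y)]
    [∀ Y, InnerProductSpace ℂ (V Y)]
    (act : ∀ {Y Z : E.Obj}, E.Hom Y Z → (V Y →L[ℂ] V Z))
    (act_add : ∀ {Y Z : E.Obj} (e e' : E.Hom Y Z), act (e + e') = act e + act e')
    (act_smul : ∀ {Y Z : E.Obj} (c : ℂ) (e : E.Hom Y Z), act (c • e) = c • act e)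
    (act_comp : ∀ {X Y Z : E.Obj} (e : E.Hom Y Z) (e' : E.Hom X Y),
      act (E.comp e e') = (act e) ∘L (act e'))
    (adj : ∀ {Y Z : E.Obj} (e : E.Hom Y Z) (v : V Y) (w : V Z),
      ⟪act e v, w⟫_ℂ = ⟪v, act (E.star e) w⟫_ℂ) :
    ∃ (B : Type) (_ : NonUnitalCStarAlgebra B) (ρ : StarFunctor E (StarCatNu.ofAlgebra B)),
      (∀ {Y Z : E.Obj} (e : E.Hom Y Z) (v : V Y), ‖act e v‖ ≤ ‖ρ.rv e‖ * ‖v‖) ∧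
      (∀ {Y Z : E.Obj} (e : E.Hom Y Z), (∀ v, ‖act e v‖ = 0) → ρ.map e = 0) := by
  have cadj : ∀ {Y Z : E.Obj} (e : E.Hom Y Z),
      (act (E.star e)).completion = ContinuousLinearMap.adjoint (act e).completion := by
    intro Y Z e
    rw [ContinuousLinearMap.eq_adjoint_iff]
    intro x y
    induction x, y using Completion.induction_on₂ with
    | hp => exact isClosed_eq (by fun_prop) (by fun_prop)
    | ih x y =>
      simp only [ContinuousLinearMap.completion_apply_coe, Completion.inner_coe]
      rw [adj, E.star_star] 
  let S := gnsS V
  have hS : ∀ Y x, (ContinuousLinearMap.adjoint (S Y)) (S Y x) = x := fun Y x =>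
    DFunLike.congr_fun (gnsS_adj V Y) x
  let R : ∀ {Y Z : E.Obj}, E.Hom Y Z → (GnsH V →L[ℂ] GnsH V) := fun {Y Z} e =>
    S Z ∘L (act e).completion ∘L (ContinuousLinearMap.adjoint (S Y))
  refine ⟨GnsH V →L[ℂ] GnsH V, inferInstance,
    { obj := fun _ => PUnit.unit
      map := fun e => R e
      map_add := ?_
      map_smul := ?_
      map_comp := ?_
      map_star := ?_ }, ?_, ?_⟩
  · intro X Y f f'
    show R (f + f') = R f + R f'
    simp only [R, act_add, cadd]
    ext1 x; simp
  · intro X Y c f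
    show R (c • f) = c • R f
    simp only [R, act_smul, csmul]
    ext1 x; simp
  · intro X Y Z g f
    show R (E.comp g f) = R g * R f
    simp only [R, act_comp, ccomp]
    ext1 x; simp [hS]
  · intro X Y f
    show R (E.star f) = star (R f)
    rw [ContinuousLinearMap.star_eq_adjoint]
    simp only [R, ContinuousLinearMap.adjoint_comp, cadj, ContinuousLinearMap.adjoint_adjoint]
    rfl
  · intro Y Z e v
    have h := (R e).le_opNorm (S Y v)
    simp only [R, ContinuousLinearMap.comp_apply, hS, S, gnsS_norm, 
      ContinuousLinearMap.completion_apply_coe, Completion.norm_coe] at h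
    exact h
  · intro Y Z e h
    have : (act e).completion = 0 := by
      ext x
      induction x using Completion.induction_on with
      | hp => exact isClosed_eq (by fun_prop) (by fun_prop)
      | ih x => 
        simp only [ContinuousLinearMap.completion_apply_coe, zero_apply]
        rw [← norm_eq_zero, Completion.norm_coe, h]
    show R e = 0
    simp [R, this]

theorem gns (E : StarCatNu) (V : E.Obj → Type) [∀ Y, AddCommGroup (V Y)]
    [∀ Y, Module ℂ (V Y)] (ip : ∀ Y, V Y → V Y → ℂ)
    (ip_symm : ∀ Y v w, (starRingEnd ℂ) (ip Y w v) = ip Y v w)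
    (ip_nonneg : ∀ Y v, 0 ≤ (ip Y v v).re)
    (ip_add : ∀ Y u v w, ip Y (u + v) w = ip Y u w + ip Y v w)
    (ip_smul : ∀ Y (c : ℂ) v w, ip Y (c • v) w = (starRingEnd ℂ) c * ip Y v w)
    (act : ∀ {Y Z : E.Obj}, E.Hom Y Z → (V Y →ₗ[ℂ] V Z))
    (act_add : ∀ {Y Z : E.Obj} (e e' : E.Hom Y Z), act (e + e') = act e + act e')
    (act_smul : ∀ {Y Z : E.Obj} (c : ℂ) (e : E.Hom Y Z), act (c • e) = c • act e)
    (act_comp : ∀ {X Y Z : E.Obj} (e : E.Hom Y Z) (e' : E.Hom X Y),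
      act (E.comp e e') = (act e) ∘ₗ (act e'))
    (adj : ∀ {Y Z : E.Obj} (e : E.Hom Y Z) (v : V Y) (w : V Z),
      ip Z (act e v) w = ip Y v (act (E.star e) w))
    (bdd : ∀ {Y Z : E.Obj} (e : E.Hom Y Z), ∃ M : ℝ, 0 ≤ M ∧
      ∀ v, (ip Z (act e v) (act e v)).re ≤ M * (ip Y v v).re) :
    ∃ (B : Type) (_ : NonUnitalCStarAlgebra B) (ρ : StarFunctor E (StarCatNu.ofAlgebra B)),
      (∀ {Y Z : E.Obj} (e : E.Hom Y Z) (v : V Y),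
        (ip Z (act e v) (act e v)).re ≤ ‖ρ.rv e‖ ^ 2 * (ip Y v v).re) ∧
      (∀ {Y Z : E.Obj} (e : E.Hom Y Z),
        (∀ v, (ip Z (act e v) (act e v)).re = 0) → ρ.map e = 0) := by
  let core : ∀ Y, PreInnerProductSpace.Core ℂ (V Y) := fun Y =>
    { inner := ip Y
      conj_inner_symm := ip_symm Y
      re_inner_nonneg := ip_nonneg Y
      add_left := ip_add Y
      smul_left := fun v w c => ip_smul Y c v w }
  let : ∀ Y, SeminormedAddCommGroup (V Y) := fun Y =>
    InnerProductSpace.Core.toSeminormedAddCommGroup (𝕜 := ℂ)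
  let : ∀ Y, InnerProductSpace ℂ (V Y) := fun Y => InnerProductSpace.ofCore (core Y)
  have hn : ∀ Y (v : V Y), ‖v‖ ^ 2 = (ip Y v v).re := by
    intro Y v
    exact (inner_self_eq_norm_sq (𝕜 := ℂ) v).symm
  have hb : ∀ {Y Z : E.Obj} (e : E.Hom Y Z), ∃ M : ℝ, ∀ v, ‖act e v‖ ≤ M * ‖v‖ := by
    intro Y Z e
    obtain ⟨M, hM, h⟩ := bdd e
    refine ⟨√M, fun v => ?_⟩
    have h1 := h v
    rw [← hn, ← hn] at h1
    rw [← Real.sqrt_sq (norm_nonneg v), ← Real.sqrt_mul hM]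
    exact Real.le_sqrt_of_sq_le h1
  obtain ⟨B, iB, ρ, h1, h2⟩ := gns1 E V
    (act := fun {Y Z} e => LinearMap.mkContinuousOfExistsBound (act e) (hb e))
    (fun e e' => by ext x; simp [act_add]) (fun e e' => by ext x; simp [act_smul])
    (fun e e' => by ext x; simp [act_comp]) (fun e v w => adj e v w)
  refine ⟨B, iB, ρ, ?_, ?_⟩
  · intro Y Z e v
    rw [← hn, ← hn, ← mul_pow]
    exact pow_le_pow_left₀ (norm_nonneg _) (h1 e v) 2
  · intro Y Z e h
    apply h2 e
    intro v
    have := h v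
    rw [← hn] at this
    exact pow_eq_zero_iff (two_ne_zero) |>.1 this
end gns

open scoped ENNReal InnerProductSpace
section state
open scoped Pointwise ComplexStarModule
variable {A : Type} [CStarAlgebra A] [PartialOrder A] [StarOrderedRing A]

theorem exists_state_real (N : Submodule ℝ A) (a : A) (ha : 0 ≤ a) (t : ℝ)
    (ht : 0 < t)
    (H : ∀ (s : ℝ), ∀ n ∈ N, a ≤ algebraMap ℝ A s + n → t ≤ s) :
    ∃ g : selfAdjoint A →ₗ[ℝ] ℝ, (∀ x : selfAdjoint A, (0 : A) ≤ x → 0 ≤ g x) ∧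
      (∀ x : selfAdjoint A, (x : A) ∈ N → g x = 0) ∧ g 1 = 1 ∧
      t ≤ g ⟨a, ha.isSelfAdjoint⟩ := by
  have key : ∀ (s : ℝ), ∀ n ∈ N, (0 : A) ≤ algebraMap ℝ A s + n → 0 ≤ s := by
    intro s n hn h
    by_contra hs
    push Not at hs
    have h1 : 0 ≤ ‖a‖ / (-s) := div_nonneg (norm_nonneg _) (by linarith)
    have h2 : t ≤ ‖a‖ + ‖a‖ / (-s) * s := by
      apply H _ ((‖a‖ / (-s)) • n) (N.smul_mem _ hn)
      have h3 : (0 : A) ≤ (‖a‖ / (-s)) • (algebraMap ℝ A s + n) := smul_nonneg h1 h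
      have h4 : a ≤ algebraMap ℝ A ‖a‖ := ha.isSelfAdjoint.le_algebraMap_norm_self
      calc a ≤ algebraMap ℝ A ‖a‖ + (‖a‖ / (-s)) • (algebraMap ℝ A s + n) := by
            simpa using add_le_add h4 h3
        _ = _ := by
            rw [smul_add, map_add, map_mul, Algebra.smul_def (‖a‖ / (-s)) (algebraMap ℝ A s)]
            abel
    have h5 : ‖a‖ / (-s) * s = -‖a‖ := by
      have : s ≠ 0 := hs.ne
      field_simp
    linarith
  let S : selfAdjoint A → Set ℝ := fun x => {s | ∃ n ∈ N, (x : A) ≤ algebraMap ℝ A s + n}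
  have Sne : ∀ x, (S x).Nonempty := fun x => ⟨‖(x : A)‖, 0, N.zero_mem, by
    simpa using IsSelfAdjoint.le_algebraMap_norm_self (a := (x : A)) x.2⟩
  have Sbd : ∀ x, BddBelow (S x) := by
    intro x
    refine ⟨-‖(x : A)‖, ?_⟩
    rintro s ⟨n, hn, h⟩
    have h1 : -algebraMap ℝ A ‖(x : A)‖ ≤ (x : A) :=
      IsSelfAdjoint.neg_algebraMap_norm_le_self (a := (x : A)) x.2
    have h2 := key (s + ‖(x : A)‖) n hn (by
      have := h1.trans h
      rw [neg_le_iff_add_nonneg] at this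
      rw [map_add]
      convert this using 1
      abel)
    linarith
  let p : selfAdjoint A → ℝ := fun x => sInf (S x)
  have hp_le : ∀ x s, s ∈ S x → p x ≤ s := fun x s h => csInf_le (Sbd x) h
  have p_add : ∀ x y, p (x + y) ≤ p x + p y := by
    intro x y
    show sInf (S (x + y)) ≤ sInf (S x) + sInf (S y)
    rw [← csInf_add (Sne x) (Sbd x) (Sne y) (Sbd y)]
    apply csInf_le_csInf (Sbd _) ((Sne x).add (Sne y))
    rintro _ ⟨s, ⟨n, hn, h⟩, s', ⟨n', hn', h'⟩, rfl⟩
    refine ⟨n + n', N.add_mem hn hn', ?_⟩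
    have := add_le_add h h'
    simp only [AddSubgroup.coe_add, map_add]
    refine this.trans (le_of_eq (by abel))
  have S_smul : ∀ (c : ℝ), 0 < c → ∀ x, c • S x ⊆ S (c • x) := by
    rintro c hc x _ ⟨s, ⟨n, hn, h⟩, rfl⟩
    refine ⟨c • n, N.smul_mem _ hn, ?_⟩
    have := smul_le_smul_of_nonneg_left h hc.le
    rw [smul_add] at this
    simp only [selfAdjoint.val_smul, smul_eq_mul, map_mul]
    rw [← Algebra.smul_def]
    exact this
  have p_smul' : ∀ (c : ℝ), 0 < c → ∀ x, p (c • x) ≤ c * p x := by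
    intro c hc x
    show sInf (S (c • x)) ≤ c * sInf (S x)
    rw [← smul_eq_mul, ← Real.sInf_smul_of_nonneg hc.le]
    exact csInf_le_csInf (Sbd _) ((Sne x).smul_set) (S_smul c hc x)
  have p_smul : ∀ (c : ℝ), 0 < c → ∀ x, p (c • x) = c * p x := by
    intro c hc x
    apply le_antisymm (p_smul' c hc x)
    have := p_smul' c⁻¹ (inv_pos.2 hc) (c • x)
    rw [smul_smul, inv_mul_cancel₀ hc.ne', one_smul] at this
    calc c * p x ≤ c * (c⁻¹ * p (c • x)) := by gcongr
      _ = _ := by field_simp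
  have p_zero : 0 ≤ p 0 := by
    apply le_csInf (Sne _)
    rintro s ⟨n, hn, h⟩
    exact key s n hn h
  have p_neg : ∀ x, - p (-x) ≤ p x := by
    intro x
    have := p_add x (-x)
    rw [add_neg_cancel] at this
    linarith
  let a' : selfAdjoint A := ⟨a, ha.isSelfAdjoint⟩
  have ha' : a' ≠ 0 := by
    intro h
    have h0 : a = 0 := congrArg Subtype.val h
    have := H 0 0 N.zero_mem (by simp [h0])
    linarith
  obtain ⟨g, hg1, hg2⟩ := exists_extension_of_le_sublinear
    (LinearPMap.mkSpanSingleton a' (p a') ha') p p_smul p_add (by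
      rintro ⟨x, hx⟩
      obtain ⟨r, rfl⟩ := Submodule.mem_span_singleton.1 hx
      have : (LinearPMap.mkSpanSingleton a' (p a') ha') ⟨r • a', hx⟩ = r • p a' :=
        LinearPMap.mkSpanSingleton'_apply _ _ _ _ _
      refine this.le.trans ?_
      show r * p a' ≤ p (r • a')
      rcases lt_trichotomy r 0 with hr | hr | hr
      · have h1 := p_smul (-r) (by linarith) a'
        have h2 := p_neg (r • a')
        rw [← neg_smul, h1] at h2
        linarith
      · simp [hr, p_zero]
      · exact (p_smul r hr a').ge)
  have hga : g a' = p a' := by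
    have h1 := hg1 ⟨a', Submodule.mem_span_singleton_self _⟩
    refine h1.trans ?_
    exact LinearPMap.mkSpanSingleton'_apply_self _ _ _ _
  have g1 : g 1 ≤ 1 := (hg2 1).trans (hp_le _ _ ⟨0, N.zero_mem, by simp⟩)
  have g2 : g (-1) ≤ -1 := (hg2 (-1)).trans (hp_le _ _ ⟨0, N.zero_mem, by simp⟩)
  have g3 : ∀ x : selfAdjoint A, (x : A) ∈ N → g x ≤ 0 := fun x hx =>
    (hg2 x).trans (hp_le _ _ ⟨x, hx, by simp⟩)
  refine ⟨g, ?_, ?_, ?_, ?_⟩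
  · intro x hx
    have := (hg2 (-x)).trans (hp_le _ 0 ⟨0, N.zero_mem, by simpa using hx⟩)
    rw [map_neg] at this
    linarith
  · intro x hx
    have h1 := g3 x hx
    have h2 := g3 (-x) (by simpa using hx)
    rw [map_neg] at h2
    linarith
  · rw [map_neg] at g2
    linarith
  · show t ≤ g a'
    rw [hga]
    apply le_csInf (Sne _)
    rintro s ⟨n, hn, h⟩
    exact H s n hn h

theorem exists_state (N : Submodule ℝ A) (a : A) (ha : 0 ≤ a) (t : ℝ)
    (ht : 0 < t)
    (H : ∀ (s : ℝ), ∀ n ∈ N, a ≤ algebraMap ℝ A s + n → t ≤ s) :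
    ∃ φ : A →ₗ[ℂ] ℂ, (∀ x, φ (star x) = (starRingEnd ℂ) (φ x)) ∧
      (∀ x, 0 ≤ x → 0 ≤ (φ x).re) ∧ (∀ x ∈ N, IsSelfAdjoint x → φ x = 0) ∧ φ 1 = 1 ∧
      t ≤ (φ a).re := by
  obtain ⟨g, g1, g2, g3, g4⟩ := exists_state_real N a ha t ht H
  let φ : A →ₗ[ℂ] ℂ := Module.Dual.extendRCLike (𝕜 := ℂ) (g ∘ₗ realPart)
  have hre : ∀ x, (φ x).re = g (ℜ x) := fun x =>
    Module.Dual.re_extendRCLike_apply (𝕜 := ℂ) (g ∘ₗ realPart) x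
  have him : ∀ x, (φ x).im = g (ℑ x) := by
    intro x
    have := Module.Dual.im_extendRCLike_apply (𝕜 := ℂ) (g ∘ₗ realPart) x
    refine this.trans ?_
    simp
  have hsa : ∀ x (hx : IsSelfAdjoint x), φ x = g ⟨x, hx⟩ := by
    intro x hx
    apply Complex.ext
    · rw [hre, Complex.ofReal_re]
      congr 1
      exact Subtype.ext hx.coe_realPart
    · rw [him, Complex.ofReal_im, hx.imaginaryPart, map_zero]
  refine ⟨φ, ?_, ?_, ?_, ?_, ?_⟩
  · intro x
    apply Complex.ext
    · rw [hre, Complex.conj_re, hre]; 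
      congr 1
      ext; simp [realPart_apply_coe, add_comm]
    · rw [him, Complex.conj_im, him, ← map_neg]
      congr 1
      ext; simp [imaginaryPart_apply_coe]
      rw [← smul_neg, ← smul_neg, neg_sub]
  · intro x hx
    rw [hsa x hx.isSelfAdjoint, Complex.ofReal_re]
    exact g1 _ hx
  · intro x hx hs
    rw [hsa x hs, g2 _ hx, Complex.ofReal_zero]
  · rw [hsa 1 (IsSelfAdjoint.one A)]
    exact_mod_cast g3
  · rw [hsa a ha.isSelfAdjoint, Complex.ofReal_re]
    exact g4
end state

open scoped ENNReal InnerProductSpace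
set_option linter.unusedVariables false
set_option linter.unusedSectionVars false

namespace StarCatNu
/-- The maximal semi-norm as a real number. -/
def nrm (C : StarCatNu) {X Y : C.Obj} (f : C.Hom X Y) : ℝ := (C.maxNorm f).toReal

theorem nrm_nonneg (C : StarCatNu) {X Y : C.Obj} (f : C.Hom X Y) : 0 ≤ C.nrm f :=
  ENNReal.toReal_nonneg

theorem rv_le_maxNorm {C : StarCatNu} {X Y : C.Obj} (f : C.Hom X Y)
    {B : Type} [NonUnitalCStarAlgebra B] (ρ : StarFunctor C (StarCatNu.ofAlgebra B)) :
    (‖ρ.rv f‖₊ : ℝ≥0∞) ≤ C.maxNorm f :=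
  le_sSup ⟨B, inferInstance, ρ, rfl⟩

theorem rv_le_nrm {C : StarCatNu} (hC : IsPreCStar C) {X Y : C.Obj} (f : C.Hom X Y)
    {B : Type} [NonUnitalCStarAlgebra B] (ρ : StarFunctor C (StarCatNu.ofAlgebra B)) :
    ‖ρ.rv f‖ ≤ C.nrm f := by
  have := ENNReal.toReal_mono (hC X Y f).ne (rv_le_maxNorm f ρ)
  rw [ENNReal.coe_toReal, coe_nnnorm] at this
  exact this

theorem maxNorm_le {C : StarCatNu} {X Y : C.Obj} (f : C.Hom X Y) {r : ℝ≥0∞}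
    (h : ∀ (B : Type) (_ : NonUnitalCStarAlgebra B)
      (ρ : StarFunctor C (StarCatNu.ofAlgebra B)), (‖ρ.rv f‖₊ : ℝ≥0∞) ≤ r) :
    C.maxNorm f ≤ r := by
  apply sSup_le
  rintro _ ⟨B, i, ρ, rfl⟩
  exact h B i ρ

theorem maxNorm_le_ofReal {C : StarCatNu} {X Y : C.Obj} (f : C.Hom X Y) {r : ℝ} (hr : 0 ≤ r)
    (h : ∀ (B : Type) (_ : NonUnitalCStarAlgebra B)
      (ρ : StarFunctor C (StarCatNu.ofAlgebra B)), ‖ρ.rv f‖ ≤ r) :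
    C.maxNorm f ≤ ENNReal.ofReal r := by
  apply maxNorm_le
  intro B i ρ
  have := h B i ρ
  rw [← ENNReal.ofReal_coe_nnreal]
  exact ENNReal.ofReal_le_ofReal this

theorem nrm_le {C : StarCatNu} {X Y : C.Obj} (f : C.Hom X Y) {r : ℝ} (hr : 0 ≤ r)
    (h : ∀ (B : Type) (_ : NonUnitalCStarAlgebra B)
      (ρ : StarFunctor C (StarCatNu.ofAlgebra B)), ‖ρ.rv f‖ ≤ r) : C.nrm f ≤ r :=
  ENNReal.toReal_le_of_le_ofReal hr (maxNorm_le_ofReal f hr h)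

theorem maxNorm_lt_iff {C : StarCatNu} (hC : IsPreCStar C) {X Y : C.Obj} (f : C.Hom X Y) {r : ℝ}
    (hr : 0 < r) : C.maxNorm f < ENNReal.ofReal r ↔ C.nrm f < r := by
  rw [← ENNReal.ofReal_toReal (hC X Y f).ne, ENNReal.ofReal_lt_ofReal_iff hr]
  rfl

section rv
variable {C : StarCatNu} {B : Type} [NonUnitalCStarAlgebra B]
    (ρ : StarFunctor C (StarCatNu.ofAlgebra B)) {X Y Z : C.Obj}

theorem rv_add (f g : C.Hom X Y) : ρ.rv (f + g) = ρ.rv f + ρ.rv g := ρ.map_add _ _ _ _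
theorem rv_zero : ρ.rv (0 : C.Hom X Y) = 0 := ρ.map_zero _ _
theorem rv_smul (c : ℂ) (f : C.Hom X Y) : ρ.rv (c • f) = c • ρ.rv f := ρ.map_smul _ _ _ _
theorem rv_comp (f : C.Hom Y Z) (g : C.Hom X Y) : ρ.rv (C.comp f g) = ρ.rv f * ρ.rv g :=
  ρ.map_comp _ _ _ _ _
theorem rv_star (f : C.Hom X Y) : ρ.rv (C.star f) = Star.star (ρ.rv f) := ρ.map_star _ _ _
end rv

section basic
variable {C : StarCatNu} {X Y Z : C.Obj}

theorem nrm_zero (hC : IsPreCStar C) : C.nrm (0 : C.Hom X Y) = 0 :=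
  le_antisymm (nrm_le _ le_rfl fun B _ ρ => by simp [rv_zero]) (C.nrm_nonneg _)

theorem nrm_add_le (hC : IsPreCStar C) (f g : C.Hom X Y) : C.nrm (f + g) ≤ C.nrm f + C.nrm g :=
  nrm_le _ (add_nonneg (C.nrm_nonneg _) (C.nrm_nonneg _)) fun B _ ρ => by
    rw [rv_add]
    exact (norm_add_le _ _).trans (add_le_add (rv_le_nrm hC _ _) (rv_le_nrm hC _ _))

theorem nrm_smul_le (hC : IsPreCStar C) (c : ℂ) (f : C.Hom X Y) : C.nrm (c • f) ≤ ‖c‖ * C.nrm f :=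
  nrm_le _ (mul_nonneg (norm_nonneg _) (C.nrm_nonneg _)) fun B _ ρ => by
    rw [rv_smul, norm_smul]
    exact mul_le_mul_of_nonneg_left (rv_le_nrm hC _ _) (norm_nonneg _)

theorem nrm_neg (hC : IsPreCStar C) (f : C.Hom X Y) : C.nrm (-f) = C.nrm f := by
  have h : ∀ g : C.Hom X Y, C.nrm (-g) ≤ C.nrm g := fun g => by
    have := nrm_smul_le hC (-1) g
    simpa using this
  apply le_antisymm (h f)
  simpa using h (-f)

theorem nrm_comp_le (hC : IsPreCStar C) (f : C.Hom Y Z) (g : C.Hom X Y) :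
    C.nrm (C.comp f g) ≤ C.nrm f * C.nrm g :=
  nrm_le _ (mul_nonneg (C.nrm_nonneg _) (C.nrm_nonneg _)) fun B _ ρ => by
    rw [rv_comp]
    exact (norm_mul_le _ _).trans (mul_le_mul (rv_le_nrm hC _ _) (rv_le_nrm hC _ _)
      (norm_nonneg _) (C.nrm_nonneg _))

theorem nrm_star (hC : IsPreCStar C) (f : C.Hom X Y) : C.nrm (C.star f) = C.nrm f := by
  have h : ∀ {X Y : C.Obj} (g : C.Hom X Y), C.nrm (C.star g) ≤ C.nrm g := fun g =>
    nrm_le _ (C.nrm_nonneg _) fun B _ ρ => by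
      rw [rv_star, norm_star]
      exact rv_le_nrm hC _ _
  apply le_antisymm (h f)
  simpa [C.star_star] using h (C.star f)

theorem nrm_star_comp (hC : IsPreCStar C) (f : C.Hom X Y) : C.nrm (C.comp (C.star f) f) = C.nrm f * C.nrm f := by
  apply le_antisymm
  · exact (nrm_comp_le hC _ _).trans (by rw [nrm_star hC])
  · rw [← pow_two]
    have : C.nrm f ≤ √(C.nrm (C.comp (C.star f) f)) := by
      apply nrm_le _ (Real.sqrt_nonneg _)
      intro B _ ρ
      apply Real.le_sqrt_of_sq_le
      have := rv_le_nrm hC (C.comp (C.star f) f) ρ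
      rw [rv_comp, rv_star, CStarRing.norm_star_mul_self] at this
      rwa [pow_two]
    calc C.nrm f ^ 2 ≤ (√(C.nrm (C.comp (C.star f) f))) ^ 2 :=
          pow_le_pow_left₀ (C.nrm_nonneg _) this 2
      _ = _ := Real.sq_sqrt (C.nrm_nonneg _)

theorem nrm_map_le (hC : IsPreCStar C) {D : StarCatNu} (F : StarFunctor C D) (f : C.Hom X Y) :
    D.nrm (F.map f) ≤ C.nrm f :=
  nrm_le _ (C.nrm_nonneg _) fun B _ ρ => rv_le_nrm hC f (F.comp ρ)

end basic

/-- Morphism space of a C*-category as a Banach space. -/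
def HomSp (C : StarCatNu) (_ : IsCStar C) (X Y : C.Obj) : Type := C.Hom X Y

section homsp
variable (C : StarCatNu) (hC : IsCStar C) (X Y : C.Obj)

instance : AddCommGroup (HomSp C hC X Y) := inferInstanceAs (AddCommGroup (C.Hom X Y))

instance : NormedAddCommGroup (HomSp C hC X Y) :=
  AddGroupNorm.toNormedAddCommGroup
    { toFun := fun f => C.nrm (X := X) (Y := Y) f
      map_zero' := nrm_zero hC.1
      add_le' := nrm_add_le hC.1
      neg' := nrm_neg hC.1
      eq_zero_of_map_eq_zero' := fun f h => by
        apply hC.2.1 X Y f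
        rcases (ENNReal.toReal_eq_zero_iff _).1 h with h | h
        · exact h
        · exact absurd h (hC.1 X Y f).ne }

theorem HomSp.norm_def (f : HomSp C hC X Y) : ‖f‖ = C.nrm (X := X) (Y := Y) f := rfl

instance : CompleteSpace (HomSp C hC X Y) := by
  apply Metric.complete_of_cauchySeq_tendsto
  intro u hu
  rw [Metric.cauchySeq_iff] at hu
  obtain ⟨f, hf⟩ := hC.2.2 X Y u (by
    intro ε hε
    by_cases h : ε = ⊤
    · exact ⟨0, fun m _ n _ => h ▸ hC.1 X Y _⟩
    have h0 : 0 < ε.toReal := ENNReal.toReal_pos hε.ne' h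
    obtain ⟨N, hN⟩ := hu ε.toReal h0
    refine ⟨N, fun m hm n hn => ?_⟩
    have := hN m hm n hn
    rw [dist_eq_norm, HomSp.norm_def] at this
    rw [← ENNReal.ofReal_toReal h]
    exact (maxNorm_lt_iff hC.1 _ h0).2 this)
  refine ⟨(show HomSp C hC X Y from f), ?_⟩
  rw [Metric.tendsto_atTop]
  intro ε hε
  obtain ⟨N, hN⟩ := hf (ENNReal.ofReal ε) (ENNReal.ofReal_pos.2 hε)
  refine ⟨N, fun n hn => ?_⟩
  rw [dist_eq_norm, HomSp.norm_def]
  exact (maxNorm_lt_iff hC.1 _ hε).1 (hN n hn)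
end homsp

theorem eq_zero_of_nrm {C : StarCatNu} (hC : IsCStar C) {X Y : C.Obj} {f : C.Hom X Y}
    (h : C.nrm f = 0) : f = 0 := norm_eq_zero (E := HomSp C hC X Y) |>.1 h

/-- The endomorphism algebra of an object with unit in a C*-category. -/
def EndAlg (C : StarCatNu) (_ : IsCStar C) (X : C.Obj) (e : C.Hom X X)
    (_ : IsIdentityAt C e) : Type := C.Hom X X

section endalg
variable (C : StarCatNu) (hC : IsCStar C) (X : C.Obj) (e : C.Hom X X) (he : IsIdentityAt C e)

instance : NormedAddCommGroup (EndAlg C hC X e he) :=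
  inferInstanceAs (NormedAddCommGroup (HomSp C hC X X))

instance : CompleteSpace (EndAlg C hC X e he) :=
  inferInstanceAs (CompleteSpace (HomSp C hC X X))

instance : Module ℂ (EndAlg C hC X e he) := inferInstanceAs (Module ℂ (C.Hom X X))

instance : Ring (EndAlg C hC X e he) :=
  { (inferInstance : AddCommGroup (EndAlg C hC X e he)) with
    mul := fun f g => C.comp (X := X) (Y := X) (Z := X) f g
    one := e
    mul_assoc := fun f g h => C.comp_assoc _ _ _
    one_mul := fun f => he.2 X f
    mul_one := fun f => he.1 X f
    left_distrib := fun f g h => C.comp_add _ _ _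
    right_distrib := fun f g h => C.add_comp _ _ _
    zero_mul := fun f => C.zero_comp _
    mul_zero := fun f => C.comp_zero _ }

theorem EndAlg.mul_def (f g : EndAlg C hC X e he) :
    f * g = C.comp (X := X) (Y := X) (Z := X) f g := rfl

instance : NormedRing (EndAlg C hC X e he) :=
  { (inferInstance : Ring (EndAlg C hC X e he)),
    (inferInstance : NormedAddCommGroup (EndAlg C hC X e he)) with
    norm_mul_le := fun f g => nrm_comp_le hC.1 _ _ }

instance : StarRing (EndAlg C hC X e he) where
  star f := C.star (X := X) (Y := X) f
  star_involutive f := C.star_star _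
  star_mul f g := C.star_comp _ _
  star_add f g := C.star_add _ _

instance : Algebra ℂ (EndAlg C hC X e he) :=
  Algebra.ofModule (fun c f g => C.smul_comp _ _ _) (fun c f g => C.comp_smul _ _ _)

instance : NormedAlgebra ℂ (EndAlg C hC X e he) where
  norm_smul_le c f := nrm_smul_le hC.1 c _

instance : CStarRing (EndAlg C hC X e he) where
  norm_mul_self_le f := (nrm_star_comp hC.1 _).ge

instance : StarModule ℂ (EndAlg C hC X e he) where
  star_smul c f := C.star_smul c _

instance : CStarAlgebra (EndAlg C hC X e he) where

instance : PartialOrder (EndAlg C hC X e he) := CStarAlgebra.spectralOrder _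
instance : StarOrderedRing (EndAlg C hC X e he) := CStarAlgebra.spectralOrderedRing _

/-- An endomorphism as an element of the endomorphism algebra. -/
def toEnd (f : C.Hom X X) : EndAlg C hC X e he := f

theorem exists_sq (hC : IsCStar C) (X : C.Obj) (e : C.Hom X X) (he : IsIdentityAt C e) (Y : C.Obj) (f : C.Hom X Y) :
    ∃ r : C.Hom X X, C.comp (C.star f) f + C.comp (C.star r) r
      = ((C.nrm f * C.nrm f : ℝ) : ℂ) • e := by
  let x : EndAlg C hC X e he := toEnd C hC X e he (C.comp (C.star f) f)
  have hx : IsSelfAdjoint x := by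
    show C.star (C.comp (C.star f) f) = _
    rw [C.star_comp, C.star_star]; rfl
  have h1 := sub_nonneg.2 hx.le_algebraMap_norm_self
  rw [CStarAlgebra.nonneg_iff_eq_star_mul_self] at h1
  obtain ⟨r, hr⟩ := h1
  refine ⟨r, ?_⟩
  have h2 : x + Star.star r * r = algebraMap ℝ _ ‖x‖ := by rw [← hr]; abel
  have h3 : ‖x‖ = C.nrm f * C.nrm f := nrm_star_comp hC.1 f
  rw [h3] at h2
  refine Eq.trans h2 ?_
  rw [Algebra.algebraMap_eq_smul_one]
  rfl

theorem star_comp_aux {C : StarCatNu} (hC : IsCStar C) {X Y : C.Obj} (f : C.Hom X Y)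
    (n y : C.Hom X X) (hn : C.star n = n)
    (h : C.comp (C.comp n (C.comp (C.star f) f)) n + C.comp (C.star y) y = 0) : y = 0 := by
  apply eq_zero_of_nrm hC
  apply le_antisymm _ (C.nrm_nonneg _)
  apply nrm_le _ le_rfl
  intro B _ ρ
  let _ : PartialOrder B := CStarAlgebra.spectralOrder B
  have _ : StarOrderedRing B := CStarAlgebra.spectralOrderedRing B
  have h0 : C.comp (C.star (C.comp f n)) (C.comp f n) + C.comp (C.star y) y = 0 := by
    rw [← h, C.star_comp, hn, C.comp_assoc, C.comp_assoc, C.comp_assoc]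
  have h2 : Star.star (ρ.rv (C.comp f n)) * ρ.rv (C.comp f n) + Star.star (ρ.rv y) * ρ.rv y = 0 := by
    rw [← rv_star, ← rv_star, ← rv_comp, ← rv_comp, ← rv_add, h0, rv_zero]
  have h3 : Star.star (ρ.rv y) * ρ.rv y = 0 :=
    le_antisymm (by
      have := star_mul_self_nonneg (ρ.rv (C.comp f n))
      rw [← h2]
      exact le_add_of_nonneg_left this) (star_mul_self_nonneg _)
  rw [CStarRing.star_mul_self_eq_zero_iff] at h3
  rw [h3, norm_zero]

theorem star_comp_nonneg (Y : C.Obj) (f : C.Hom X Y) :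
    0 ≤ toEnd C hC X e he (C.comp (C.star f) f) := by
  set x : EndAlg C hC X e he := toEnd C hC X e he (C.comp (C.star f) f) with hxdef
  have hx : IsSelfAdjoint x := by
    show C.star (C.comp (C.star f) f) = _
    rw [C.star_comp, C.star_star]; rfl
  -- the negative part
  let n : EndAlg C hC X e he := x⁻
  have hn : 0 ≤ n := CFC.negPart_nonneg x
  have hnn : Star.star n = n := hn.isSelfAdjoint
  have hnx : n * x * n = -(n * n * n) := by
    have h1 : x = x⁺ - x⁻ := (CFC.posPart_sub_negPart x hx).symm
    have h2 : x⁻ * x⁺ = 0 := CFC.negPart_mul_posPart x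
    calc n * x * n = n * (x⁺ - x⁻) * n := by rw [← h1]
      _ = (x⁻ * x⁺ - x⁻ * x⁻) * n := by rw [mul_sub]
      _ = _ := by rw [h2, zero_sub, neg_mul]
  obtain ⟨y, hy⟩ : ∃ y : EndAlg C hC X e he, n * n * n = Star.star y * y := by
    rw [← CStarAlgebra.nonneg_iff_eq_star_mul_self]
    have := star_left_conjugate_nonneg hn n
    rwa [hnn] at this
  have hy0 : y = 0 := by
    refine star_comp_aux hC f n y hnn ?_
    show n * x * n + Star.star y * y = 0
    rw [hnx, hy, neg_add_cancel]
  have hn0 : n = 0 := by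
    rw [hy0, mul_zero] at hy
    have h4 : Star.star (n * n) * (n * n) = 0 := by
      rw [star_mul, hnn, ← mul_assoc, hy, zero_mul]
    have h5 := (CStarRing.star_mul_self_eq_zero_iff _).1 h4
    have h6 : Star.star n * n = 0 := by rw [hnn, h5]
    exact (CStarRing.star_mul_self_eq_zero_iff _).1 h6
  exact (CFC.negPart_eq_zero_iff x hx).1 hn0
end endalg
end StarCatNu

open scoped ENNReal InnerProductSpace
set_option linter.unusedVariables false
set_option linter.unusedSectionVars false

namespace StarCatNu

section cast
variable {C : StarCatNu} {X X' X'' Y Y' Y'' Z Z' : C.Obj}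

theorem castHom_rfl (f : C.Hom X Y) : C.castHom rfl rfl f = f := rfl

theorem castHom_self (hX : X = X) (hY : Y = Y) (f : C.Hom X Y) : C.castHom hX hY f = f := rfl

theorem castHom_add (hX : X = X') (hY : Y = Y') (f g : C.Hom X Y) :
    C.castHom hX hY (f + g) = C.castHom hX hY f + C.castHom hX hY g := by
  subst hX hY; rfl

theorem castHom_zero (hX : X = X') (hY : Y = Y') :
    C.castHom hX hY (0 : C.Hom X Y) = 0 := by
  subst hX hY; rfl

theorem castHom_smul (hX : X = X') (hY : Y = Y') (c : ℂ) (f : C.Hom X Y) :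
    C.castHom hX hY (c • f) = c • C.castHom hX hY f := by
  subst hX hY; rfl

theorem castHom_sum (hX : X = X') (hY : Y = Y') {ι : Type} (s : Finset ι) (f : ι → C.Hom X Y) :
    C.castHom hX hY (s.sum f) = s.sum fun k => C.castHom hX hY (f k) := by
  subst hX hY; rfl

theorem castHom_comp (hX : X = X') (hY : Y = Y') (hZ : Z = Z') (g : C.Hom Y Z) (f : C.Hom X Y) :
    C.castHom hX hZ (C.comp g f) = C.comp (C.castHom hY hZ g) (C.castHom hX hY f) := by
  subst hX hY hZ; rfl

theorem castHom_star (hX : X = X') (hY : Y = Y') (f : C.Hom X Y) :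
    C.castHom hY hX (C.star f) = C.star (C.castHom hX hY f) := by
  subst hX hY; rfl

theorem castHom_castHom (hX : X = X') (hY : Y = Y') (hX' : X' = X'') (hY' : Y' = Y'')
    (f : C.Hom X Y) :
    C.castHom hX' hY' (C.castHom hX hY f) = C.castHom (hX.trans hX') (hY.trans hY') f := by
  subst hX hY hX' hY'; rfl

theorem map_castHom {D : StarCatNu} (F : StarFunctor C D) (hX : X = X') (hY : Y = Y')
    (f : C.Hom X Y) :
    F.map (C.castHom hX hY f) = D.castHom (congrArg F.obj hX) (congrArg F.obj hY) (F.map f) := by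
  subst hX hY; rfl

theorem castHom_inj (hX : X = X') (hY : Y = Y') {f g : C.Hom X Y}
    (h : C.castHom hX hY f = C.castHom hX hY g) : f = g := by
  subst hX hY; exact h

theorem castHom_eq_zero (hX : X = X') (hY : Y = Y') {f : C.Hom X Y}
    (h : C.castHom hX hY f = 0) : f = 0 := by
  subst hX hY; exact h

theorem castHom_surj (hX : X = X') (hY : Y = Y') (g : C.Hom X' Y') :
    ∃ f : C.Hom X Y, C.castHom hX hY f = g := by
  subst hX hY; exact ⟨g, rfl⟩

theorem castHom_eq_iff (hX : X = X') (hY : Y = Y') (f : C.Hom X Y) (g : C.Hom X' Y') :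
    C.castHom hX hY f = g ↔ f = C.castHom hX.symm hY.symm g := by
  subst hX hY; rfl

theorem rv_castHom {B : Type} [NonUnitalCStarAlgebra B] (ρ : StarFunctor C (ofAlgebra B))
    (hX : X = X') (hY : Y = Y') (f : C.Hom X Y) : ρ.rv (C.castHom hX hY f) = ρ.rv f := by
  subst hX hY; rfl
end cast

/-- Functors agreeing on objects and (up to transport) on morphisms are equal. -/
theorem functor_ext {C D : StarCatNu} (F F' : StarFunctor C D) (ho : ∀ X, F.obj X = F'.obj X)
    (hm : ∀ X Y (f : C.Hom X Y), D.castHom (ho X) (ho Y) (F.map f) = F'.map f) : F = F' := by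
  obtain ⟨o, m, _, _, _, _⟩ := F
  obtain ⟨o', m', _, _, _, _⟩ := F'
  have : o = o' := funext ho
  subst this
  have : @m = @m' := by
    funext X Y f
    exact hm X Y f
  subst this
  rfl

/-- Pull back a category along a map of object sets. -/
def pull (C : StarCatNu) {O : Type} (σ : O → C.Obj) : StarCatNu where
  Obj := O
  Hom X Y := C.Hom (σ X) (σ Y)
  comp g f := C.comp g f
  star f := C.star f
  comp_assoc h g f := C.comp_assoc h g f
  add_comp g g' f := C.add_comp g g' f
  comp_add g f f' := C.comp_add g f f'
  smul_comp c g f := C.smul_comp c g f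
  comp_smul c g f := C.comp_smul c g f
  star_star f := C.star_star f
  star_comp g f := C.star_comp g f
  star_add f f' := C.star_add f f'
  star_smul c f := C.star_smul c f

/-- Constructor for functors out of a pull-back. -/
def pullFunctor (C : StarCatNu) {O : Type} (σ : O → C.Obj) {D : StarCatNu} (o : O → D.Obj)
    (m : ∀ X Y, C.Hom (σ X) (σ Y) → D.Hom (o X) (o Y))
    (m_add : ∀ X Y f f', m X Y (f + f') = m X Y f + m X Y f')
    (m_smul : ∀ X Y (c : ℂ) f, m X Y (c • f) = c • m X Y f)
    (m_comp : ∀ X Y Z (g : C.Hom (σ Y) (σ Z)) (f : C.Hom (σ X) (σ Y)),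
      m X Z (C.comp g f) = D.comp (m Y Z g) (m X Y f))
    (m_star : ∀ X Y (f : C.Hom (σ X) (σ Y)), m Y X (C.star f) = D.star (m X Y f)) :
    StarFunctor (pull C σ) D where
  obj := o
  map {X Y} f := m X Y f
  map_add X Y f f' := m_add X Y f f'
  map_smul X Y c f := m_smul X Y c f
  map_comp X Y Z g f := m_comp X Y Z g f
  map_star X Y f := m_star X Y f

/-- A functor on a pull-back along a bijection extends to the category. -/
theorem extend (C : StarCatNu) {O : Type} (σ : O → C.Obj) (hσ : Function.Bijective σ)
    {D : StarCatNu} (H : StarFunctor (pull C σ) D) :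
    ∃ (H' : StarFunctor C D) (ho : ∀ X, H'.obj (σ X) = H.obj X),
      ∀ X Y (u : C.Hom (σ X) (σ Y)),
        D.castHom (ho X) (ho Y) (H'.map u) = H.map (X := X) (Y := Y) u := by
  let τ : C.Obj → O := Function.surjInv hσ.2
  have hτ : ∀ A, A = σ (τ A) := fun A => (Function.surjInv_eq hσ.2 A).symm
  have hτ' : ∀ X, τ (σ X) = X := fun X => hσ.1 (Function.surjInv_eq hσ.2 (σ X))
  refine ⟨{ obj := fun A => H.obj (τ A)
            map := fun {A B} u => H.map (X := τ A) (Y := τ B) (C.castHom (hτ A) (hτ B) u)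
            map_add := ?_, map_smul := ?_, map_comp := ?_, map_star := ?_ }, ?_, ?_⟩
  · intro A B f f'
    rw [castHom_add]; exact H.map_add _ _ _ _
  · intro A B c f
    rw [castHom_smul]; exact H.map_smul _ _ _ _
  · intro A B E g f
    rw [castHom_comp _ (hτ B)]; exact H.map_comp _ _ _ _ _
  · intro A B f
    rw [castHom_star]; exact H.map_star _ _ _
  · intro X
    show H.obj (τ (σ X)) = _
    rw [hτ']
  · intro X Y u
    show D.castHom _ _ (H.map (X := τ (σ X)) (Y := τ (σ Y)) (C.castHom (hτ _) (hτ _) u)) = _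
    have key : ∀ (X' Y' : O) (hX : X' = X) (hY : Y' = Y) (a : σ X = σ X') (b : σ Y = σ Y')
        (c : H.obj X' = H.obj X) (d : H.obj Y' = H.obj Y),
        D.castHom c d (H.map (X := X') (Y := Y') (C.castHom a b u))
          = H.map (X := X) (Y := Y) u := by
      intro X' Y' hX hY; subst hX hY; intros; rfl
    exact key _ _ (hτ' X) (hτ' Y) _ _ _ _

theorem extend_rv (C : StarCatNu) {O : Type} (σ : O → C.Obj) (hσ : Function.Bijective σ)
    {B : Type} [NonUnitalCStarAlgebra B] (H : StarFunctor (pull C σ) (ofAlgebra B)) :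
    ∃ (H' : StarFunctor C (ofAlgebra B)),
      ∀ X Y (u : C.Hom (σ X) (σ Y)), H'.rv u = H.rv (X := X) (Y := Y) u := by
  obtain ⟨H', ho, h⟩ := extend C σ hσ H
  exact ⟨H', fun X Y u => h X Y u⟩

/-- Representations killing the kernel descend along quotient morphisms. -/
theorem descend {E Q : StarCatNu} (p : StarFunctor E Q) (hp : IsQuotientHom p)
    {B : Type} [NonUnitalCStarAlgebra B] (π : StarFunctor E (ofAlgebra B))
    (hk : ∀ X Y (f : E.Hom X Y), p.map f = 0 → π.rv f = 0) :
    ∃ π' : StarFunctor Q (ofAlgebra B), ∀ X Y (f : E.Hom X Y), π'.rv (p.map f) = π.rv f := by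
  have hk' : ∀ X Y (f g : E.Hom X Y), p.map f = p.map g → π.rv f = π.rv g := by
    intro X Y f g h
    have h1 : p.map (f + (-1 : ℂ) • g) = 0 := by
      rw [p.map_add, p.map_smul, h]; simp
    have h2 := hk X Y _ h1
    rw [rv_add, rv_smul] at h2
    have : π.rv f - π.rv g = 0 := by rw [← h2]; simp [sub_eq_add_neg]
    exact sub_eq_zero.1 this
  choose s hs using hp.2
  have hs' : ∀ X Y (u : Q.Hom (p.obj X) (p.obj Y)), p.map (s X Y u) = u := hs
  let H : StarFunctor (pull Q p.obj) (ofAlgebra B) :=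
    pullFunctor Q p.obj (D := ofAlgebra B) (fun _ => PUnit.unit) (fun X Y u => π.rv (s X Y u))
      (fun X Y f f' => by
        refine Eq.trans ?_ (rv_add π _ _)
        apply hk'
        rw [p.map_add]; simp only [hs'])
      (fun X Y c f => by
        refine Eq.trans ?_ (rv_smul π _ _)
        apply hk'
        rw [p.map_smul]; simp only [hs'])
      (fun X Y Z g f => by
        refine Eq.trans ?_ (rv_comp π _ _)
        apply hk'
        rw [p.map_comp]; simp only [hs'])
      (fun X Y f => by
        refine Eq.trans ?_ (rv_star π _)
        apply hk'
        rw [p.map_star]; simp only [hs'])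
  obtain ⟨H', hH⟩ := extend_rv Q p.obj hp.1 H
  refine ⟨H', fun X Y f => ?_⟩
  rw [hH]
  exact hk' _ _ _ _ (hs' _ _ _)

end StarCatNu

open scoped ENNReal InnerProductSpace
set_option linter.unusedVariables false
set_option linter.unusedSectionVars false

namespace StarCatNu
theorem alg_cut {A : Type} [CStarAlgebra A] [PartialOrder A] [StarOrderedRing A]
    (a n : A) (s ε : ℝ) (hε : 0 < ε) (ha : 0 ≤ a) (hn : IsSelfAdjoint n)
    (h : a ≤ algebraMap ℝ A s + n) :
    ∃ b k : A, 1 - b = n * k ∧ IsSelfAdjoint b ∧ ‖b * a * b‖ ≤ max s 0 + ε := by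
  set s' : ℝ := max s 0 + ε with hs'
  have hs0 : 0 < s' := by positivity
  set j : A := (1 / (4 * ε)) • (n * n) with hj
  have hnn : 0 ≤ n * n := by
    have := star_mul_self_nonneg n
    rwa [hn.star_eq] at this
  have hj0 : 0 ≤ j := smul_nonneg (by positivity) hnn
  have hnle : n ≤ algebraMap ℝ A ε + j := by
    have h1 : 0 ≤ ((2 * ε) • (1 : A) - n) * ((2 * ε) • (1 : A) - n) := by
      have h2 : IsSelfAdjoint ((2 * ε) • (1 : A) - n) :=
        (IsSelfAdjoint.smul (IsSelfAdjoint.all (2 * ε)) (IsSelfAdjoint.one A)).sub hn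
      have := star_mul_self_nonneg ((2 * ε) • (1 : A) - n)
      rwa [h2.star_eq] at this
    have h3 : (1 / (4 * ε)) • (((2 * ε) • (1 : A) - n) * ((2 * ε) • (1 : A) - n))
        = algebraMap ℝ A ε + j - n := by
      rw [hj, Algebra.algebraMap_eq_smul_one]
      simp only [sub_mul, mul_sub, smul_mul_assoc, mul_smul_comm, one_mul, mul_one, smul_sub,
        smul_smul]
      have e1 : 1 / (4 * ε) * (2 * ε * (2 * ε)) = ε := by field_simp; norm_num
      have e2 : 1 / (4 * ε) * (2 * ε) = 1 / 2 := by field_simp; norm_num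
      rw [e1, e2]
      module
    have h4 : (0 : A) ≤ (1 / (4 * ε)) • (((2 * ε) • (1 : A) - n) * ((2 * ε) • (1 : A) - n)) :=
      smul_nonneg (by positivity) h1
    rw [h3] at h4
    exact sub_nonneg.1 h4
  set w : A := algebraMap ℝ A s' + j with hw
  have haw : a ≤ w := by
    have h1 : algebraMap ℝ A s ≤ algebraMap ℝ A (max s 0) := algebraMap_mono A (le_max_left _ _)
    calc a ≤ algebraMap ℝ A s + n := h
      _ ≤ algebraMap ℝ A (max s 0) + (algebraMap ℝ A ε + j) := add_le_add h1 hnle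
      _ = w := by rw [hw, hs', map_add]; abel
  have hwu : IsUnit w := by
    have h0 : (0 : A) ≤ algebraMap ℝ A s' := by
      rw [Algebra.algebraMap_eq_smul_one]; exact smul_nonneg hs0.le zero_le_one
    have h1 : IsStrictlyPositive (algebraMap ℝ A s') :=
      ⟨h0, (IsUnit.mk0 s' hs0.ne').map (algebraMap ℝ A)⟩
    exact CStarAlgebra.isUnit_of_le (algebraMap ℝ A s') (b := w) (le_add_of_nonneg_right hj0) h1
  obtain ⟨v, hv⟩ := hwu
  have hwsa : IsSelfAdjoint w := (ha.trans haw).isSelfAdjoint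
  set i : A := ((v⁻¹ : Aˣ) : A) with hi
  have hiw : i * w = 1 := by rw [← hv]; exact v.inv_mul
  have hwi : w * i = 1 := by rw [← hv]; exact v.mul_inv
  have hisa : Star.star i = i := by
    have h1 : Star.star i * w = 1 := by
      have := congrArg Star.star hwi
      rwa [star_mul, hwsa.star_eq, star_one] at this
    calc Star.star i = Star.star i * (w * i) := by rw [hwi, mul_one]
      _ = i := by rw [← mul_assoc, h1, one_mul]
  obtain ⟨b, hb⟩ : ∃ b : A, b = s' • i := ⟨_, rfl⟩
  have hbsa : IsSelfAdjoint b := by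
    rw [hb]
    show Star.star (s' • i) = _
    rw [StarModule.star_smul, hisa, star_trivial]
  have hbw : b * w = algebraMap ℝ A s' := by
    rw [hb, smul_mul_assoc, hiw, Algebra.algebraMap_eq_smul_one]
  have hbwb : b * w * b = s' • b := by
    rw [hbw, Algebra.algebraMap_eq_smul_one, smul_mul_assoc, one_mul]
  have hconj : ∀ x y : A, x ≤ y → b * x * b ≤ b * y * b := fun x y hxy => by
    have := star_left_conjugate_le_conjugate hxy b
    rwa [hbsa.star_eq] at this
  have hbb : b * b ≤ b := by
    have h1 := hconj _ _ (le_add_of_nonneg_right hj0 : algebraMap ℝ A s' ≤ w)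
    rw [hbwb, Algebra.algebraMap_eq_smul_one, mul_smul_comm, mul_one, smul_mul_assoc] at h1
    have h2 := smul_le_smul_of_nonneg_left h1 (inv_nonneg.2 hs0.le)
    rwa [smul_smul, smul_smul, inv_mul_cancel₀ hs0.ne', one_smul, one_smul] at h2
  have hb1 : b ≤ 1 := by
    have h1 : 0 ≤ (1 - b) * (1 - b) := by
      have := star_mul_self_nonneg (1 - b)
      rwa [((IsSelfAdjoint.one A).sub hbsa).star_eq] at this
    have h2 := add_nonneg h1 (sub_nonneg.2 hbb)
    have h3 : (1 - b) * (1 - b) + (b - b * b) = 1 - b := by noncomm_ring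
    rw [h3] at h2
    exact sub_nonneg.1 h2
  refine ⟨b, (1 / (4 * ε)) • (n * i), ?_, hbsa, ?_⟩
  · have h1 : (w - algebraMap ℝ A s') * i = 1 - b := by
      rw [sub_mul, hwi, Algebra.algebraMap_eq_smul_one, smul_mul_assoc, one_mul, hb]
    rw [← h1, hw, add_sub_cancel_left, hj, smul_mul_assoc, mul_smul_comm, mul_assoc]
  · have h0 : 0 ≤ b * a * b := by simpa using hconj 0 a ha
    have h1 : b * a * b ≤ algebraMap ℝ A s' := by
      refine (hconj a w haw).trans ?_
      rw [hbwb, Algebra.algebraMap_eq_smul_one]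
      exact smul_le_smul_of_nonneg_left hb1 hs0.le
    exact (CStarAlgebra.norm_le_iff_le_algebraMap _ hs0.le h0).2 h1
end StarCatNu

open scoped ENNReal InnerProductSpace
set_option linter.unusedVariables false
set_option linter.unusedSectionVars false

namespace StarCatNu
theorem exists_state_hom {C : StarCatNu} (hC : IsCStar C) {X : C.Obj} (e : C.Hom X X)
    (he : IsIdentityAt C e) (J : C.Hom X X → Prop) (J0 : J 0)
    (Jadd : ∀ x y, J x → J y → J (x + y)) (Jsmul : ∀ (c : ℂ) x, J x → J (c • x))
    {Y : C.Obj} (u : C.Hom X Y) (t : ℝ) (ht : 0 < t)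
    (H : ∀ h n k : C.Hom X X, J n → e - h = C.comp n k → t ≤ C.nrm (C.comp u h)) :
    ∃ φ : C.Hom X X →ₗ[ℂ] ℂ, (∀ x, φ (C.star x) = (starRingEnd ℂ) (φ x)) ∧
      (∀ (Z : C.Obj) (f : C.Hom X Z), 0 ≤ (φ (C.comp (C.star f) f)).re) ∧
      (∀ x, J x → C.star x = x → φ x = 0) ∧ φ e = 1 ∧
      t ^ 2 ≤ (φ (C.comp (C.star u) u)).re := by
  let a : EndAlg C hC X e he := toEnd C hC X e he (C.comp (C.star u) u)
  have ha : 0 ≤ a := star_comp_nonneg C hC X e he Y u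
  let N : Submodule ℝ (EndAlg C hC X e he) :=
    { carrier := {x | IsSelfAdjoint x ∧ J x}
      add_mem' := fun {x y} hx hy => ⟨hx.1.add hy.1, Jadd _ _ hx.2 hy.2⟩
      zero_mem' := ⟨IsSelfAdjoint.zero _, J0⟩
      smul_mem' := fun r x hx =>
        ⟨IsSelfAdjoint.smul (IsSelfAdjoint.all r) hx.1, Jsmul (r : ℂ) _ hx.2⟩ }
  obtain ⟨φ, h1, h2, h3, h4, h5⟩ := exists_state N a ha (t ^ 2) (by positivity) (by
    intro s n hn hle
    have key : ∀ ε : ℝ, 0 < ε → t ^ 2 ≤ max s 0 + ε := by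
      intro ε hε
      obtain ⟨b, k, hb1, hb2, hb3⟩ := alg_cut a n s ε hε ha hn.1 hle
      have h6 := H b n k hn.2 hb1
      have h7 : C.nrm (C.comp u b) * C.nrm (C.comp u b) = ‖b * a * b‖ := by
        rw [← nrm_star_comp hC.1]
        have : ∀ b' : C.Hom X X, C.star b' = b' →
            C.nrm (C.comp (C.star (C.comp u b')) (C.comp u b'))
            = C.nrm (C.comp (C.comp b' (C.comp (C.star u) u)) b') := by
          intro b' hb'
          rw [C.star_comp, hb', C.comp_assoc, C.comp_assoc, C.comp_assoc]
        exact this b hb2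
      calc t ^ 2 ≤ C.nrm (C.comp u b) ^ 2 := pow_le_pow_left₀ ht.le h6 2
        _ = ‖b * a * b‖ := by rw [pow_two]; exact h7
        _ ≤ _ := hb3
    have h8 : t ^ 2 ≤ max s 0 := le_of_forall_pos_le_add key
    rcases le_max_iff.1 h8 with h | h
    · exact h
    · exact absurd h (not_le.2 (by positivity)))
  exact ⟨φ, h1, fun Z f => h2 _ (star_comp_nonneg C hC X e he Z f),
    fun x hx hs => h3 x ⟨hs, hx⟩ hs, h4, h5⟩

/-- boundedness estimate -/
theorem state_bdd {C : StarCatNu} (hC : IsCStar C) {X Y Z : C.Obj} (e : C.Hom Y Y)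
    (he : IsIdentityAt C e) (φ : C.Hom X X →ₗ[ℂ] ℂ)
    (hφ : ∀ (Z : C.Obj) (f : C.Hom X Z), 0 ≤ (φ (C.comp (C.star f) f)).re)
    (x : C.Hom Y Z) (v : C.Hom X Y) :
    (φ (C.comp (C.star (C.comp x v)) (C.comp x v))).re
      ≤ (C.nrm x * C.nrm x) * (φ (C.comp (C.star v) v)).re := by
  obtain ⟨r, hr⟩ := exists_sq C hC Y e he Z x
  have h1 := hφ Y (C.comp r v)
  have h2 : C.comp (C.star (C.comp x v)) (C.comp x v) + C.comp (C.star (C.comp r v)) (C.comp r v)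
      = ((C.nrm x * C.nrm x : ℝ) : ℂ) • C.comp (C.star v) v := by
    rw [C.star_comp, C.star_comp, C.comp_assoc, C.comp_assoc, ← C.comp_assoc (C.star x),
      ← C.comp_assoc (C.star r), ← C.comp_add, ← C.add_comp, hr, C.smul_comp, C.comp_smul, he.2]
  have h3 := congrArg (fun z => (φ z).re) h2
  simp only [map_add, Complex.add_re, map_smul, smul_eq_mul, Complex.re_ofReal_mul] at h3
  linarith

theorem sub_comp (C : StarCatNu) {X Y Z : C.Obj} (g g' : C.Hom Y Z) (f : C.Hom X Y) :
    C.comp (g - g') f = C.comp g f - C.comp g' f :=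
  (AddMonoidHom.mk' (fun g : C.Hom Y Z => C.comp g f) (fun a b => C.add_comp a b f)).map_sub _ _

theorem comp_sub (C : StarCatNu) {X Y Z : C.Obj} (g : C.Hom Y Z) (f f' : C.Hom X Y) :
    C.comp g (f - f') = C.comp g f - C.comp g f' :=
  (AddMonoidHom.mk' (fun f : C.Hom X Y => C.comp g f) (C.comp_add g)).map_sub _ _

theorem star_sub' (C : StarCatNu) {X Y : C.Obj} (f f' : C.Hom X Y) :
    C.star (f - f') = C.star f - C.star f' :=
  (AddMonoidHom.mk' (fun f : C.Hom X Y => C.star f) C.star_add).map_sub _ _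

theorem map_sub {C D : StarCatNu} (F : StarFunctor C D) {X Y : C.Obj} (f f' : C.Hom X Y) :
    F.map (f - f') = F.map f - F.map f' :=
  (AddMonoidHom.mk' (fun f : C.Hom X Y => F.map f) (F.map_add X Y)).map_sub _ _

section J
variable {E Ec Q : StarCatNu} (κ : StarFunctor E Ec) (hκ : IsCompletion E Ec κ)
  (p : StarFunctor E Q)

/-- The closure of the kernel of `p` in the completion. -/
def InJ {A B : E.Obj} (h : Ec.Hom (κ.obj A) (κ.obj B)) : Prop :=
  ∀ ε : ℝ, 0 < ε → ∃ c : E.Hom A B, p.map c = 0 ∧ Ec.nrm (h - κ.map c) < ε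

variable {κ p} {A B D : E.Obj}

theorem dense_nrm (hκ : IsCompletion E Ec κ) (h : Ec.Hom (κ.obj A) (κ.obj B)) (ε : ℝ)
    (hε : 0 < ε) : ∃ f : E.Hom A B, Ec.nrm (h - κ.map f) < ε := by
  obtain ⟨f, hf⟩ := hκ.dense A B h (ENNReal.ofReal ε) (ENNReal.ofReal_pos.2 hε)
  exact ⟨f, (maxNorm_lt_iff hκ.cstar.1 _ hε).1 hf⟩

theorem InJ_map (hκ : IsCompletion E Ec κ) (c : E.Hom A B) (hc : p.map c = 0) :
    InJ κ p (κ.map c) := fun ε hε =>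
  ⟨c, hc, by rw [sub_self, nrm_zero hκ.cstar.1]; exact hε⟩

theorem InJ_zero (hκ : IsCompletion E Ec κ) :
    InJ κ p (0 : Ec.Hom (κ.obj A) (κ.obj B)) := fun ε hε =>
  ⟨0, p.map_zero _ _, by rw [κ.map_zero, sub_self, nrm_zero hκ.cstar.1]; exact hε⟩

theorem InJ_add (hκ : IsCompletion E Ec κ) (x y : Ec.Hom (κ.obj A) (κ.obj B))
    (hx : InJ κ p x) (hy : InJ κ p y) : InJ κ p (x + y) := by
  intro ε hε
  obtain ⟨c, hc, h1⟩ := hx (ε / 2) (by positivity)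
  obtain ⟨d, hd, h2⟩ := hy (ε / 2) (by positivity)
  refine ⟨c + d, by rw [p.map_add, hc, hd, add_zero], ?_⟩
  have : x + y - κ.map (c + d) = (x - κ.map c) + (y - κ.map d) := by rw [κ.map_add]; abel
  rw [this]
  have := nrm_add_le hκ.cstar.1 (x - κ.map c) (y - κ.map d)
  linarith

theorem InJ_smul (hκ : IsCompletion E Ec κ) (z : ℂ) (x : Ec.Hom (κ.obj A) (κ.obj B))
    (hx : InJ κ p x) : InJ κ p (z • x) := by
  intro ε hε
  obtain ⟨c, hc, h1⟩ := hx (ε / (‖z‖ + 1)) (by positivity)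
  refine ⟨z • c, by rw [p.map_smul, hc, smul_zero], ?_⟩
  rw [κ.map_smul, ← smul_sub]
  have h2 := nrm_smul_le hκ.cstar.1 z (x - κ.map c)
  rw [lt_div_iff₀ (by positivity)] at h1
  have := Ec.nrm_nonneg (x - κ.map c)
  nlinarith [norm_nonneg z]

theorem InJ_star (hκ : IsCompletion E Ec κ) (x : Ec.Hom (κ.obj A) (κ.obj B))
    (hx : InJ κ p x) : InJ κ p (Ec.star x) := by
  intro ε hε
  obtain ⟨c, hc, h1⟩ := hx ε hε
  refine ⟨E.star c, by rw [p.map_star, hc, Q.star_zero'], ?_⟩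
  rw [κ.map_star, ← star_sub', nrm_star hκ.cstar.1]
  exact h1

theorem InJ_comp_left (hκ : IsCompletion E Ec κ) (y : Ec.Hom (κ.obj B) (κ.obj D))
    (x : Ec.Hom (κ.obj A) (κ.obj B)) (hx : InJ κ p x) : InJ κ p (Ec.comp y x) := by
  intro ε hε
  have hy0 := Ec.nrm_nonneg y
  obtain ⟨c, hc, h1⟩ := hx (ε / 2 / (Ec.nrm y + 1)) (by positivity)
  have hc0 := Ec.nrm_nonneg (κ.map c)
  obtain ⟨d, h2⟩ := dense_nrm hκ y (ε / 2 / (Ec.nrm (κ.map c) + 1)) (by positivity)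
  refine ⟨E.comp d c, by rw [p.map_comp, hc, Q.comp_zero], ?_⟩
  have e1 : Ec.comp y x - κ.map (E.comp d c)
      = Ec.comp y (x - κ.map c) + Ec.comp (y - κ.map d) (κ.map c) := by
    rw [κ.map_comp, comp_sub, sub_comp]; abel
  rw [e1]
  have h3 := nrm_add_le hκ.cstar.1 (Ec.comp y (x - κ.map c)) (Ec.comp (y - κ.map d) (κ.map c))
  have h4 := nrm_comp_le hκ.cstar.1 y (x - κ.map c)
  have h5 := nrm_comp_le hκ.cstar.1 (y - κ.map d) (κ.map c)
  rw [lt_div_iff₀ (by positivity)] at h1 h2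
  have := Ec.nrm_nonneg (x - κ.map c)
  have := Ec.nrm_nonneg (y - κ.map d)
  nlinarith

theorem InJ_comp_right (hκ : IsCompletion E Ec κ) (y : Ec.Hom (κ.obj A) (κ.obj B))
    (x : Ec.Hom (κ.obj B) (κ.obj D)) (hx : InJ κ p x) : InJ κ p (Ec.comp x y) := by
  have := InJ_star hκ _ (InJ_comp_left hκ (Ec.star y) _ (InJ_star hκ _ hx))
  rwa [Ec.star_comp, Ec.star_star, Ec.star_star] at this

theorem quotNorm (hκ : IsCompletion E Ec κ)
    (hu : ∀ A : E.Obj, ∃ e : Ec.Hom (κ.obj A) (κ.obj A), IsIdentityAt Ec e)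
    (hp : IsQuotientHom p) (hQ : IsPreCStar Q) (u : E.Hom A B) (t : ℝ)
    (ht : Q.nrm (p.map u) < t) :
    ∃ c : E.Hom A B, p.map c = 0 ∧ Ec.nrm (κ.map u - κ.map c) < t := by
  by_contra hcon
  push Not at hcon
  have hE := hκ.cstar
  have ht0 : 0 < t := (Q.nrm_nonneg _).trans_lt ht
  obtain ⟨e, he⟩ := hu A
  have hJ : ∀ h : Ec.Hom (κ.obj A) (κ.obj B), InJ κ p h → t ≤ Ec.nrm (κ.map u - h) := by
    intro h hh
    apply le_of_forall_pos_le_add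
    intro ε hε
    obtain ⟨c, hc, h1⟩ := hh ε hε
    have h2 := hcon c hc
    have h3 := nrm_add_le hE.1 (κ.map u - h) (h - κ.map c)
    rw [sub_add_sub_cancel] at h3
    linarith
  obtain ⟨φ, h1, h2, h3, h4, h5⟩ := exists_state_hom hE e he (InJ κ p) (InJ_zero hκ)
    (InJ_add hκ) (InJ_smul hκ) (κ.map u) t ht0 (by
      intro h n k hn hk
      have h6 : InJ κ p (Ec.comp (κ.map u) (e - h)) := by
        rw [hk]
        exact InJ_comp_left hκ _ _ (InJ_comp_right hκ _ _ hn)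
      have h7 := hJ _ h6
      rwa [comp_sub, he.1, sub_sub_cancel] at h7)
  obtain ⟨B', iB, ρ, hρ1, hρ2⟩ := gns E (fun Y => Ec.Hom (κ.obj A) (κ.obj Y))
    (fun Y v w => φ (Ec.comp (Ec.star v) w))
    (fun Y v w => by rw [← h1, Ec.star_comp, Ec.star_star])
    (fun Y v => h2 _ v)
    (fun Y u v w => by rw [Ec.star_add, Ec.add_comp, map_add])
    (fun Y c v w => by rw [Ec.star_smul, Ec.smul_comp, map_smul, smul_eq_mul])
    (fun {Y Z} x => { toFun := fun v => Ec.comp (κ.map x) v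
                      map_add' := fun v w => Ec.comp_add _ _ _
                      map_smul' := fun c v => Ec.comp_smul _ _ _ })
    (fun x y => by ext v; simp [κ.map_add, Ec.add_comp])
    (fun c y => by ext v; simp [κ.map_smul, Ec.smul_comp])
    (fun x y => by ext v; simp [κ.map_comp, Ec.comp_assoc])
    (fun x v w => by
      simp only [LinearMap.coe_mk, AddHom.coe_mk]
      rw [Ec.star_comp, κ.map_star, Ec.comp_assoc])
    (fun {Y Z} x => ⟨Ec.nrm (κ.map x) * Ec.nrm (κ.map x),
      mul_nonneg (Ec.nrm_nonneg _) (Ec.nrm_nonneg _), fun v => by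
        obtain ⟨eY, heY⟩ := hu Y
        exact state_bdd hE eY heY φ h2 (κ.map x) v⟩)
  have hk : ∀ X Y (f : E.Hom X Y), p.map f = 0 → ρ.rv f = 0 := by
    intro X Y f hf
    apply hρ2 f
    intro v
    have h6 : φ (Ec.comp (Ec.star (Ec.comp (κ.map f) v)) (Ec.comp (κ.map f) v)) = 0 := by
      apply h3
      · exact InJ_comp_left hκ _ _ (InJ_comp_right hκ _ _ (InJ_map hκ f hf))
      · rw [Ec.star_comp, Ec.star_star]
    show (φ (Ec.comp (Ec.star (Ec.comp (κ.map f) v)) (Ec.comp (κ.map f) v))).re = 0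
    rw [h6]; rfl
  obtain ⟨π, hπ⟩ := descend p hp ρ hk
  have h6 := rv_le_nrm hQ (p.map u) π
  rw [hπ] at h6
  have h7 := hρ1 u e
  have h8 : t ^ 2 ≤ ‖ρ.rv u‖ ^ 2 := by
    have e1 : (φ (Ec.comp (Ec.star e) e)).re = 1 := by
      have : Ec.star e = e := by
        calc Ec.star e = Ec.comp (Ec.star e) e := (he.1 _ _).symm
          _ = Ec.star (Ec.comp (Ec.star e) e) := by rw [Ec.star_comp, Ec.star_star]
          _ = e := by rw [he.1, Ec.star_star]
      rw [this, he.1, h4]; rfl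
    have e2 : (φ (Ec.comp (Ec.star (Ec.comp (κ.map u) e)) (Ec.comp (κ.map u) e))).re
      ≤ ‖ρ.rv u‖ ^ 2 * (φ (Ec.comp (Ec.star e) e)).re := h7
    rw [e1, mul_one, he.1] at e2
    exact h5.trans e2
  have h9 := (sq_le_sq₀ ht0.le (norm_nonneg _)).1 h8
  linarith
end J
end StarCatNu

open scoped ENNReal InnerProductSpace
set_option linter.unusedVariables false
set_option linter.unusedSectionVars false

namespace StarCatNu
theorem exists_state_nonunital {B : Type} [NonUnitalCStarAlgebra B] (b : B) (hb : 0 < ‖b‖) :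
    ∃ ψ : B →ₗ[ℂ] ℂ, (∀ x, ψ (Star.star x) = (starRingEnd ℂ) (ψ x)) ∧
      (∀ x, 0 ≤ (ψ (Star.star x * x)).re) ∧
      ‖b‖ ^ 4 ≤ (ψ (Star.star (b * Star.star b) * (b * Star.star b))).re ∧
      (ψ (b * Star.star b)).re ≤ ‖b‖ ^ 2 := by
  let A := Unitization ℂ B
  let _ : PartialOrder A := CStarAlgebra.spectralOrder A
  have _ : StarOrderedRing A := CStarAlgebra.spectralOrderedRing A
  let ι : B →ₗ[ℂ] A := (Unitization.inrHom ℂ ℂ B)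
  have ιm : ∀ x y, ι (x * y) = ι x * ι y := fun x y => Unitization.inr_mul ℂ x y
  have ιs : ∀ x, ι (Star.star x) = Star.star (ι x) := fun x => Unitization.inr_star x
  have ιn : ∀ x, ‖ι x‖ = ‖x‖ := fun x => Unitization.norm_inr x
  set c : B := b * Star.star b with hc
  have hcn : ‖c‖ = ‖b‖ * ‖b‖ := CStarRing.norm_self_mul_star
  let a : A := ι (Star.star c * c)
  have ha : 0 ≤ a := by
    show 0 ≤ ι (Star.star c * c)
    rw [ιm, ιs]; exact star_mul_self_nonneg _
  have han : ‖a‖ = ‖b‖ ^ 4 := by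
    show ‖ι (Star.star c * c)‖ = _
    rw [ιn, CStarRing.norm_star_mul_self, hcn]; ring
  obtain ⟨φ, h1, h2, h3, h4, h5⟩ := exists_state (⊥ : Submodule ℝ A) a ha (‖b‖ ^ 4)
    (by positivity) (by
      intro s n hn hle
      rw [Submodule.mem_bot] at hn
      rw [hn, add_zero] at hle
      by_cases hs : 0 ≤ s
      · rw [← han]
        exact (CStarAlgebra.norm_le_iff_le_algebraMap a hs ha).2 hle
      · exfalso
        have hs' : algebraMap ℝ A s ≤ algebraMap ℝ A 0 := algebraMap_mono A (not_le.1 hs).le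
        rw [map_zero] at hs'
        have : a = 0 := le_antisymm (hle.trans hs') ha
        rw [this, norm_zero] at han
        have : 0 < ‖b‖ ^ 4 := by positivity
        linarith)
  refine ⟨φ ∘ₗ ι, fun x => ?_, fun x => ?_, h5, ?_⟩
  · show φ (ι _) = _
    rw [ιs, h1]; rfl
  · show 0 ≤ (φ (ι _)).re
    rw [ιm, ιs]; exact h2 _ (star_mul_self_nonneg _)
  · show (φ (ι c)).re ≤ _
    have hsa : IsSelfAdjoint (ι c) := by
      show Star.star (ι c) = _
      rw [← ιs, hc, star_mul, _root_.star_star]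
    have h6 := h2 _ (sub_nonneg.2 hsa.le_algebraMap_norm_self)
    rw [_root_.map_sub, Complex.sub_re, Algebra.algebraMap_eq_smul_one, ιn, hcn] at h6
    have h7 : φ ((‖b‖ * ‖b‖ : ℝ) • (1 : A)) = ((‖b‖ * ‖b‖ : ℝ) : ℂ) := by
      have : (‖b‖ * ‖b‖ : ℝ) • (1 : A) = ((‖b‖ * ‖b‖ : ℝ) : ℂ) • (1 : A) :=
        (Complex.coe_smul _ _).symm
      rw [this, map_smul, h4, smul_eq_mul, mul_one]
    rw [h7, Complex.ofReal_re] at h6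
    nlinarith

theorem gnsPull (E : StarCatNu) {O : Type} (σ : O → E.Obj) (hσ : Function.Bijective σ)
    (V : O → Type) [iA : ∀ Y, AddCommGroup (V Y)]
    [iM : ∀ Y, Module ℂ (V Y)] (ip : ∀ Y, V Y → V Y → ℂ)
    (ip_symm : ∀ Y v w, (starRingEnd ℂ) (ip Y w v) = ip Y v w)
    (ip_nonneg : ∀ Y v, 0 ≤ (ip Y v v).re)
    (ip_add : ∀ Y u v w, ip Y (u + v) w = ip Y u w + ip Y v w)
    (ip_smul : ∀ Y (c : ℂ) v w, ip Y (c • v) w = (starRingEnd ℂ) c * ip Y v w)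
    (act : ∀ Y Z, E.Hom (σ Y) (σ Z) → (V Y →ₗ[ℂ] V Z))
    (act_add : ∀ Y Z (e e' : E.Hom (σ Y) (σ Z)), act Y Z (e + e') = act Y Z e + act Y Z e')
    (act_smul : ∀ Y Z (c : ℂ) (e : E.Hom (σ Y) (σ Z)), act Y Z (c • e) = c • act Y Z e)
    (act_comp : ∀ X Y Z (e : E.Hom (σ Y) (σ Z)) (e' : E.Hom (σ X) (σ Y)),
      act X Z (E.comp e e') = (act Y Z e) ∘ₗ (act X Y e'))
    (adj : ∀ Y Z (e : E.Hom (σ Y) (σ Z)) (v : V Y) (w : V Z),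
      ip Z (act Y Z e v) w = ip Y v (act Z Y (E.star e) w))
    (bdd : ∀ Y Z (e : E.Hom (σ Y) (σ Z)), ∃ M : ℝ, 0 ≤ M ∧
      ∀ v, (ip Z (act Y Z e v) (act Y Z e v)).re ≤ M * (ip Y v v).re) :
    ∃ (B : Type) (_ : NonUnitalCStarAlgebra B) (ρ : StarFunctor E (StarCatNu.ofAlgebra B)),
      ∀ Y Z (e : E.Hom (σ Y) (σ Z)) (v : V Y),
        (ip Z (act Y Z e v) (act Y Z e v)).re ≤ ‖ρ.rv e‖ ^ 2 * (ip Y v v).re := by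
  obtain ⟨B, iB, π, h1, -⟩ := @gns (pull E σ) V iA iM ip ip_symm ip_nonneg ip_add ip_smul
    (fun {Y Z} e => act Y Z e) (fun {Y Z} e e' => act_add Y Z e e')
    (fun {Y Z} c e => act_smul Y Z c e) (fun {X Y Z} e e' => act_comp X Y Z e e')
    (fun {Y Z} e v w => adj Y Z e v w) (fun {Y Z} e => bdd Y Z e)
  obtain ⟨π', hπ'⟩ := extend_rv E σ hσ π
  refine ⟨B, iB, π', fun Y Z e v => ?_⟩
  rw [hπ']
  exact h1 (Y := Y) (Z := Z) e v

theorem isom {F E : StarCatNu} (j : StarFunctor F E) (hj : Function.Bijective j.obj)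
    (hinj : ∀ X Y (f g : F.Hom X Y), j.map f = j.map g → f = g)
    (hideal : ∀ X Y Z (e : E.Hom (j.obj Y) (j.obj Z)) (v : F.Hom X Y),
      ∃ w : F.Hom X Z, j.map w = E.comp e (j.map v))
    (hgen : ∀ Y Z (P : E.Hom (j.obj Y) (j.obj Z) → Prop), P 0 → (∀ x y, P x → P y → P (x + y)) →
      (∀ e, (∃ M : ℝ, 0 ≤ M ∧ ∃ r : E.Hom (j.obj Y) (j.obj Y), ∀ X (x : E.Hom X (j.obj Y)),
        E.comp (E.star e) (E.comp e x) + E.comp (E.star r) (E.comp r x) = (M : ℂ) • x) → P e) →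
      ∀ e, P e)
    (hE : IsPreCStar E) {X Y : F.Obj} (f : F.Hom X Y) : F.nrm f ≤ E.nrm (j.map f) := by
  apply nrm_le _ (E.nrm_nonneg _)
  intro B _ ρ
  set b := ρ.rv f with hbdef
  rcases (norm_nonneg b).eq_or_lt with hb | hb
  · rw [← hb]; exact E.nrm_nonneg _
  obtain ⟨ψ, h1, h2, h3, h4⟩ := exists_state_nonunital b hb
  choose act hact using hideal Y
  -- inner product
  let ip : ∀ Z, F.Hom Y Z → F.Hom Y Z → ℂ := fun Z v w => ψ (Star.star (ρ.rv v) * ρ.rv w)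
  have ip_eq : ∀ Z v w, ip Z v w = ψ (ρ.rv (F.comp (F.star v) w)) := fun Z v w => by
    rw [rv_comp, rv_star]
  have act_add : ∀ W Z (e e' : E.Hom (j.obj W) (j.obj Z)) v,
      act W Z (e + e') v = act W Z e v + act W Z e' v := fun W Z e e' v => by
    apply hinj; rw [j.map_add, hact, hact, hact, E.add_comp]
  have act_zero : ∀ W Z v, act W Z 0 v = 0 := fun W Z v => by
    apply hinj; rw [j.map_zero, hact, E.zero_comp]
  have act_smul : ∀ W Z (c : ℂ) (e : E.Hom (j.obj W) (j.obj Z)) v,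
      act W Z (c • e) v = c • act W Z e v := fun W Z c e v => by
    apply hinj; rw [j.map_smul, hact, hact, E.smul_comp]
  have act_comp : ∀ U W Z (e : E.Hom (j.obj W) (j.obj Z)) (e' : E.Hom (j.obj U) (j.obj W)) v,
      act U Z (E.comp e e') v = act W Z e (act U W e' v) := fun U W Z e e' v => by
    apply hinj; rw [hact, hact, hact, E.comp_assoc]
  have act_vadd : ∀ W Z (e : E.Hom (j.obj W) (j.obj Z)) v w,
      act W Z e (v + w) = act W Z e v + act W Z e w := fun W Z e v w => by
    apply hinj; rw [j.map_add, hact, hact, hact, j.map_add, E.comp_add]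
  have act_vsmul : ∀ W Z (e : E.Hom (j.obj W) (j.obj Z)) (c : ℂ) v,
      act W Z e (c • v) = c • act W Z e v := fun W Z e c v => by
    apply hinj; rw [j.map_smul, hact, hact, j.map_smul, E.comp_smul]
  have adj : ∀ W Z (e : E.Hom (j.obj W) (j.obj Z)) (v : F.Hom Y W) (w : F.Hom Y Z),
      ip Z (act W Z e v) w = ip W v (act Z W (E.star e) w) := fun W Z e v w => by
    rw [ip_eq, ip_eq]
    congr 2
    apply hinj
    rw [j.map_comp, j.map_comp, j.map_star, j.map_star, hact, hact, E.star_comp, E.comp_assoc]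
  have bdd : ∀ W Z (e : E.Hom (j.obj W) (j.obj Z)), ∃ M : ℝ, 0 ≤ M ∧
      ∀ v, (ip Z (act W Z e v) (act W Z e v)).re ≤ M * (ip W v v).re := by
    intro W Z
    apply hgen
    · refine ⟨0, le_rfl, fun v => ?_⟩
      rw [act_zero]
      show (ψ (Star.star (ρ.rv (0 : F.Hom Y Z)) * ρ.rv (0 : F.Hom Y Z))).re ≤ _
      rw [rv_zero]; simp
    · rintro x y ⟨M, hM, hx⟩ ⟨M', hM', hy⟩
      refine ⟨2 * M + 2 * M', by positivity, fun v => ?_⟩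
      rw [act_add]
      have h5 := hx v
      have h6 := hy v
      have h7 : ∀ p q : F.Hom Y Z, (ip Z (p + q) (p + q)).re
          ≤ 2 * (ip Z p p).re + 2 * (ip Z q q).re := by
        intro p q
        have h8 := h2 (ρ.rv p - ρ.rv q)
        have h9 : Star.star (ρ.rv p + ρ.rv q) * (ρ.rv p + ρ.rv q)
            + Star.star (ρ.rv p - ρ.rv q) * (ρ.rv p - ρ.rv q)
            = (Star.star (ρ.rv p) * ρ.rv p + Star.star (ρ.rv p) * ρ.rv p)
              + (Star.star (ρ.rv q) * ρ.rv q + Star.star (ρ.rv q) * ρ.rv q) := by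
          rw [StarAddMonoid.star_add, star_sub]; noncomm_ring
        have h10 := congrArg (fun z => (ψ z).re) h9
        simp only [_root_.map_add, Complex.add_re] at h10
        show (ψ (Star.star (ρ.rv (p + q)) * ρ.rv (p + q))).re ≤ 2 * (ψ (Star.star (ρ.rv p) * ρ.rv p)).re
          + 2 * (ψ (Star.star (ρ.rv q) * ρ.rv q)).re
        rw [rv_add]
        linarith
      have := h7 (act W Z x v) (act W Z y v)
      linarith
    · rintro e ⟨M, hM, r, hr⟩
      refine ⟨M, hM, fun v => ?_⟩
      have h5 : F.comp (F.star (act W Z e v)) (act W Z e v)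
          + F.comp (F.star (act W W r v)) (act W W r v) = (M : ℂ) • F.comp (F.star v) v := by
        apply hinj
        rw [j.map_add, j.map_smul, j.map_comp, j.map_comp, j.map_comp, j.map_star, j.map_star,
          j.map_star, hact, hact, E.star_comp, E.star_comp, E.comp_assoc, E.comp_assoc,
          ← E.comp_add, hr, E.comp_smul]
      have h6 := congrArg (fun z => (ψ (ρ.rv z)).re) h5
      simp only [rv_add, rv_smul, _root_.map_add, map_smul, Complex.add_re, smul_eq_mul,
        Complex.re_ofReal_mul] at h6
      rw [← ip_eq, ← ip_eq, ← ip_eq] at h6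
      have h7 : 0 ≤ (ip W (act W W r v) (act W W r v)).re := h2 _
      linarith
  obtain ⟨B', iB, π', hπ1⟩ := gnsPull E j.obj hj (fun Z => F.Hom Y Z) ip
    (fun Z v w => by rw [ip_eq, ip_eq, ← h1, ← rv_star, F.star_comp, F.star_star])
    (fun Z v => h2 _)
    (fun Z u v w => by rw [ip_eq, ip_eq, ip_eq, F.star_add, F.add_comp, rv_add, _root_.map_add])
    (fun Z c v w => by rw [ip_eq, ip_eq, F.star_smul, F.smul_comp, rv_smul, map_smul, smul_eq_mul])
    (fun W Z e => { toFun := fun v => act W Z e v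
                    map_add' := fun v w => act_vadd W Z e v w
                    map_smul' := fun c v => act_vsmul W Z e c v })
    (fun W Z x y => LinearMap.ext fun v => act_add W Z x y v)
    (fun W Z c y => LinearMap.ext fun v => act_smul W Z c y v)
    (fun U W Z x y => LinearMap.ext fun v => act_comp U W Z x y v)
    (fun W Z x v w => adj W Z x v w)
    (fun W Z x => bdd W Z x)
  have h5 : (ip Y (act X Y (j.map f) (F.star f)) (act X Y (j.map f) (F.star f))).re
      ≤ ‖π'.rv (j.map f)‖ ^ 2 * (ip X (F.star f) (F.star f)).re :=
    hπ1 X Y (j.map f) (F.star f)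
  have h6 : act X Y (j.map f) (F.star f) = F.comp f (F.star f) := by
    apply hinj; rw [hact, j.map_comp]
  have h7 : ip Y (F.comp f (F.star f)) (F.comp f (F.star f))
      = ψ (Star.star (b * Star.star b) * (b * Star.star b)) := by
    show ψ _ = _
    rw [rv_comp, rv_star]
  have h8 : ip X (F.star f) (F.star f) = ψ (b * Star.star b) := by
    show ψ _ = _
    rw [rv_star, _root_.star_star]
  rw [h6, h7, h8] at h5
  have h9 := rv_le_nrm hE (j.map f) π'
  refine le_trans ?_ h9
  have h10 : ‖b‖ ^ 4 ≤ ‖π'.rv (j.map f)‖ ^ 2 * ‖b‖ ^ 2 :=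
    h3.trans (h5.trans (mul_le_mul_of_nonneg_left h4 (by positivity)))
  have h11 : ‖b‖ ^ 2 ≤ ‖π'.rv (j.map f)‖ ^ 2 := by
    apply le_of_mul_le_mul_right _ (by positivity : 0 < ‖b‖ ^ 2)
    calc ‖b‖ ^ 2 * ‖b‖ ^ 2 = ‖b‖ ^ 4 := by ring
      _ ≤ _ := h10
  exact (sq_le_sq₀ (norm_nonneg _) (norm_nonneg _)).1 h11
end StarCatNu

open scoped ENNReal InnerProductSpace
set_option linter.unusedVariables false
set_option linter.unusedSectionVars false

namespace StarCatNu

theorem unit_completion {E Ec : StarCatNu} {κ : StarFunctor E Ec} (hκ : IsCompletion E Ec κ)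
    {A : E.Obj} (e : E.Hom A A) (he : IsIdentityAt E e) : IsIdentityAt Ec (κ.map e) := by
  have hE := hκ.cstar
  have he0 := Ec.nrm_nonneg (κ.map e)
  have hr : ∀ (Y : Ec.Obj) (f : Ec.Hom (κ.obj A) Y), Ec.comp f (κ.map e) = f := by
    intro Y' h
    obtain ⟨Y, rfl⟩ := hκ.obj_bij.2 Y'
    apply sub_eq_zero.1
    apply eq_zero_of_nrm hE
    apply le_antisymm _ (Ec.nrm_nonneg _)
    apply le_of_forall_pos_le_add
    intro ε hε
    obtain ⟨f, hf⟩ := dense_nrm hκ h (ε / (Ec.nrm (κ.map e) + 1)) (by positivity)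
    rw [lt_div_iff₀ (by positivity)] at hf
    have h1 : Ec.comp h (κ.map e) - h
        = Ec.comp (h - κ.map f) (κ.map e) + -(h - κ.map f) := by
      rw [sub_comp, ← κ.map_comp, he.1]; abel
    have h2 := nrm_add_le hE.1 (Ec.comp (h - κ.map f) (κ.map e)) (-(h - κ.map f))
    rw [← h1, nrm_neg hE.1] at h2
    have h3 := nrm_comp_le hE.1 (h - κ.map f) (κ.map e)
    linarith
  have hs : Ec.star (κ.map e) = κ.map e := by
    have : E.star e = e := by
      calc E.star e = E.comp (E.star e) e := (he.1 _ _).symm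
        _ = E.star (E.comp (E.star e) e) := by rw [E.star_comp, E.star_star]
        _ = e := by rw [he.1, E.star_star]
    rw [← κ.map_star, this]
  refine ⟨hr, fun Y g => ?_⟩
  have := congrArg (fun z => Ec.star z) (hr Y (Ec.star g))
  simpa only [Ec.star_comp, Ec.star_star, hs] using this

/-- A functor between C*-categories as a bounded group homomorphism. -/
def toNGH {C D : StarCatNu} (hC : IsCStar C) (hD : IsCStar D) (F : StarFunctor C D) (X Y : C.Obj) :
    NormedAddGroupHom (HomSp C hC X Y) (HomSp D hD (F.obj X) (F.obj Y)) where
  toFun f := F.map (X := X) (Y := Y) f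
  map_add' f g := F.map_add X Y f g
  bound' := ⟨1, fun f => by rw [one_mul]; exact nrm_map_le hC.1 F _⟩

theorem main2 {CG DG QG CGc DGc QGc : StarCatNu} (j : StarFunctor CG DG) (pa : StarFunctor DG QG)
    (hex : IsExactSeq j pa) (κC : StarFunctor CG CGc) (κD : StarFunctor DG DGc)
    (κQ : StarFunctor QG QGc) (hκC : IsCompletion CG CGc κC) (hκD : IsCompletion DG DGc κD)
    (hκQ : IsCompletion QG QGc κQ) (iG : StarFunctor CGc DGc) (pG : StarFunctor DGc QGc)
    (h1 : κC.comp iG = j.comp κD) (h2 : κD.comp pG = pa.comp κQ) (hunit : DG.IsUnital)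
    (hgen : ∀ (Y Z : DG.Obj) (P : DG.Hom Y Z → Prop), P 0 → (∀ x y, P x → P y → P (x + y)) →
      (∀ e, (∃ M : ℝ, 0 ≤ M ∧ ∃ r : DG.Hom Y Y, ∀ X (x : DG.Hom X Y),
        DG.comp (DG.star e) (DG.comp e x) + DG.comp (DG.star r) (DG.comp r x) = (M : ℂ) • x) →
          P e) → ∀ e, P e) :
    IsExactSeq iG pG := by
  have hC := hκC.cstar
  have hD := hκD.cstar
  have hQ := hκQ.cstar
  have nD : ∀ {X Y : DG.Obj} (f : DG.Hom X Y), DGc.nrm (κD.map f) = DG.nrm f :=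
    fun f => congrArg ENNReal.toReal (hκD.isometric _ _ f)
  have nC : ∀ {X Y : CG.Obj} (f : CG.Hom X Y), CGc.nrm (κC.map f) = CG.nrm f :=
    fun f => congrArg ENNReal.toReal (hκC.isometric _ _ f)
  have nQ : ∀ {X Y : QG.Obj} (f : QG.Hom X Y), QGc.nrm (κQ.map f) = QG.nrm f :=
    fun f => congrArg ENNReal.toReal (hκQ.isometric _ _ f)
  have hu : ∀ A : DG.Obj, ∃ e : DGc.Hom (κD.obj A) (κD.obj A), IsIdentityAt DGc e := fun A => by
    obtain ⟨e, he⟩ := hunit A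
    exact ⟨_, unit_completion hκD e he⟩
  -- objects
  have ho1 : Function.Bijective (iG.obj ∘ κC.obj) := by
    have : Function.Bijective (κC.comp iG).obj := by
      rw [h1]; exact hκD.obj_bij.comp hex.i_obj_bij
    exact this
  have ho2 : Function.Bijective (pG.obj ∘ κD.obj) := by
    have : Function.Bijective (κD.comp pG).obj := by
      rw [h2]; exact hκQ.obj_bij.comp hex.p_quot.1
    exact this
  have hiobj : Function.Bijective iG.obj := (Function.Bijective.of_comp_iff _ hκC.obj_bij).1 ho1
  have hpobj : Function.Bijective pG.obj := (Function.Bijective.of_comp_iff _ hκD.obj_bij).1 ho2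
  -- isometry
  have hisoA : ∀ {X Y : CG.Obj} (f : CG.Hom X Y), CG.nrm f ≤ DG.nrm (j.map f) := fun {X Y} f =>
    isom j hex.i_obj_bij (fun X Y f g h => hex.i_map_inj X Y h)
      (fun X Y Z e v => by
        have h3 : pa.map (DG.comp e (j.map v)) = 0 := by
          rw [pa.map_comp, (hex.exact X Y (j.map v)).2 ⟨v, rfl⟩, QG.comp_zero]
        exact (hex.exact X Z _).1 h3)
      (fun Y Z P => hgen (j.obj Y) (j.obj Z) P) hκD.pre f
  have hiso1 : ∀ {X Y : CG.Obj} (f : CG.Hom X Y), CG.nrm f ≤ DGc.nrm (iG.map (κC.map f)) := by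
    have : ∀ {X Y : CG.Obj} (f : CG.Hom X Y), CG.nrm f ≤ DGc.nrm ((κC.comp iG).map f) := by
      rw [h1]
      intro X Y f
      show _ ≤ DGc.nrm (κD.map (j.map f))
      rw [nD]; exact hisoA f
    exact fun {X Y} f => this f
  have hiso : ∀ (A B : CGc.Obj) (h : CGc.Hom A B), CGc.nrm h ≤ DGc.nrm (iG.map h) := by
    intro A B h
    obtain ⟨X, rfl⟩ := hκC.obj_bij.2 A
    obtain ⟨Y, rfl⟩ := hκC.obj_bij.2 B
    apply le_of_forall_pos_le_add
    intro ε hε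
    obtain ⟨f, hf⟩ := dense_nrm hκC h (ε / 2) (by positivity)
    have e1 := nrm_add_le hC.1 (h - κC.map f) (κC.map f)
    rw [sub_add_cancel, nC] at e1
    have e2 := hiso1 f
    have e3 := nrm_add_le hD.1 (-(iG.map (h - κC.map f))) (iG.map h)
    rw [nrm_neg hD.1, map_sub, neg_sub, sub_add_cancel, ← map_sub] at e3
    have e4 := nrm_map_le hC.1 iG (h - κC.map f)
    linarith
  -- facts on pG
  have hp1 : ∀ {X Y : DG.Obj} (f : DG.Hom X Y), QGc.nrm (pG.map (κD.map f)) = QG.nrm (pa.map f) := by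
    have : ∀ {X Y : DG.Obj} (f : DG.Hom X Y), QGc.nrm ((κD.comp pG).map f) = QG.nrm (pa.map f) := by
      rw [h2]
      intro X Y f
      exact nQ _
    exact fun {X Y} f => this f
  have hp2 : ∀ {X Y : DG.Obj} (f : DG.Hom X Y), pa.map f = 0 → pG.map (κD.map f) = 0 := by
    intro X Y f hf
    apply eq_zero_of_nrm hQ
    rw [hp1, hf, nrm_zero hκQ.pre]
  have hp3 : ∀ (X Y : DG.Obj) (h : QGc.Hom (pG.obj (κD.obj X)) (pG.obj (κD.obj Y))) (ε : ℝ),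
      0 < ε → ∃ u : DG.Hom X Y, QGc.nrm (h - pG.map (κD.map u)) < ε := by
    have aux : ∀ (X Y : DG.Obj) (h : QGc.Hom (κQ.obj (pa.obj X)) (κQ.obj (pa.obj Y))) (ε : ℝ),
        0 < ε → ∃ u : DG.Hom X Y, QGc.nrm (h - κQ.map (pa.map u)) < ε := by
      intro X Y h ε hε
      obtain ⟨f, hf⟩ := dense_nrm hκQ h ε hε
      obtain ⟨u, hu⟩ := hex.p_quot.2 X Y f
      refine ⟨u, ?_⟩
      have hu' : pa.map u = f := hu
      rw [hu']; exact hf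
    have : ∀ (X Y : DG.Obj) (h : QGc.Hom ((κD.comp pG).obj X) ((κD.comp pG).obj Y)) (ε : ℝ),
        0 < ε → ∃ u : DG.Hom X Y, QGc.nrm (h - (κD.comp pG).map u) < ε := by
      rw [h2]
      exact aux
    exact this
  have hzero : ∀ {X Y : CG.Obj} (f : CG.Hom X Y), pG.map (iG.map (κC.map f)) = 0 := by
    have : ∀ {X Y : CG.Obj} (f : CG.Hom X Y), pG.map ((κC.comp iG).map f) = 0 := by
      rw [h1]
      intro X Y f
      exact hp2 _ ((hex.exact X Y (j.map f)).2 ⟨f, rfl⟩)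
    exact fun {X Y} f => this f
  have hker : ∀ (X Y : CG.Obj) (f : DGc.Hom (iG.obj (κC.obj X)) (iG.obj (κC.obj Y))),
      pG.map f = 0 → ∀ ε : ℝ, 0 < ε → ∃ c : CG.Hom X Y, DGc.nrm (f - iG.map (κC.map c)) < ε := by
    have aux : ∀ (X Y : CG.Obj) (f : DGc.Hom (κD.obj (j.obj X)) (κD.obj (j.obj Y))),
      pG.map f = 0 → ∀ ε : ℝ, 0 < ε → ∃ c : CG.Hom X Y, DGc.nrm (f - κD.map (j.map c)) < ε := by
      intro X Y f hf ε hε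
      obtain ⟨u, hu1⟩ := dense_nrm hκD f (ε / 2) (by positivity)
      have hu2 : QG.nrm (pa.map u) < ε / 2 := by
        rw [← hp1]
        have e1 := nrm_map_le hD.1 pG (f - κD.map u)
        rw [map_sub, hf, zero_sub, nrm_neg hQ.1] at e1
        exact e1.trans_lt hu1
      obtain ⟨c', hc1, hc2⟩ := quotNorm hκD hu hex.p_quot hκQ.pre u (ε / 2) hu2
      obtain ⟨c, rfl⟩ := (hex.exact X Y c').1 hc1
      refine ⟨c, ?_⟩
      have e2 := nrm_add_le hD.1 (f - κD.map u) (κD.map u - κD.map (j.map c))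
      rw [sub_add_sub_cancel] at e2
      linarith
    have : ∀ (X Y : CG.Obj) (f : DGc.Hom ((κC.comp iG).obj X) ((κC.comp iG).obj Y)),
      pG.map f = 0 → ∀ ε : ℝ, 0 < ε → ∃ c : CG.Hom X Y, DGc.nrm (f - (κC.comp iG).map c) < ε := by
      rw [h1]
      exact aux
    exact this
  refine ⟨hiobj, ?_, ⟨hpobj, ?_⟩, ?_⟩
  · intro A B f g hfg
    have hfg' : iG.map f = iG.map g := hfg
    apply sub_eq_zero.1
    apply eq_zero_of_nrm hC
    apply le_antisymm _ (CGc.nrm_nonneg _)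
    refine (hiso A B (f - g)).trans ?_
    rw [map_sub, hfg', sub_self, nrm_zero hD.1]
  · intro A B
    obtain ⟨X, rfl⟩ := hκD.obj_bij.2 A
    obtain ⟨Y, rfl⟩ := hκD.obj_bij.2 B
    let f := toNGH hD hQ pG (κD.obj X) (κD.obj Y)
    let K : AddSubgroup (HomSp QGc hQ (pG.obj (κD.obj X)) (pG.obj (κD.obj Y))) :=
      { carrier := {y | ∃ u : DG.Hom X Y, pG.map (κD.map u) = y}
        add_mem' := by
          rintro _ _ ⟨u, rfl⟩ ⟨v, rfl⟩
          exact ⟨u + v, by rw [κD.map_add, pG.map_add]; rfl⟩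
        zero_mem' := ⟨0, by rw [κD.map_zero, pG.map_zero]; rfl⟩
        neg_mem' := by
          rintro _ ⟨u, rfl⟩
          refine ⟨0 - u, ?_⟩
          rw [map_sub, map_sub, κD.map_zero, pG.map_zero, zero_sub]; rfl }
    have hK : f.SurjectiveOnWith K 2 := by
      rintro y ⟨u, hy⟩
      have hn : ‖y‖ = QG.nrm (pa.map u) := by
        rw [← hp1 u]
        exact (congrArg (fun z => QGc.nrm z) hy).symm
      rcases (norm_nonneg y).eq_or_lt with h0 | h0
      · refine ⟨0, ?_, ?_⟩
        · rw [_root_.map_zero]; exact (norm_eq_zero.1 h0.symm).symm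
        · rw [norm_zero]; positivity
      · obtain ⟨c, hc1, hc2⟩ := quotNorm hκD hu hex.p_quot hκQ.pre u (2 * ‖y‖) (by
          rw [← hn]; linarith)
        refine ⟨κD.map u - κD.map c, ?_, hc2.le⟩
        have e1 : pG.map (κD.map u - κD.map c) = pG.map (κD.map u) := by
          rw [map_sub, hp2 c hc1, sub_zero]
        exact e1.trans hy
    have hK2 := controlled_closure_of_complete (by norm_num) (by norm_num : (0 : ℝ) < 1) hK
    have hy : ∀ y : HomSp QGc hQ (pG.obj (κD.obj X)) (pG.obj (κD.obj Y)),
        y ∈ K.topologicalClosure := by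
      intro y
      refine Metric.mem_closure_iff.2 ?_
      intro ε hε
      obtain ⟨u, hu⟩ := hp3 X Y y ε hε
      refine ⟨pG.map (κD.map u), ⟨u, rfl⟩, ?_⟩
      exact (dist_eq_norm _ _).trans_lt hu
    intro y
    obtain ⟨g, hg, -⟩ := hK2 _ (hy y)
    exact ⟨g, hg⟩
  · intro A B f
    obtain ⟨X, rfl⟩ := hκC.obj_bij.2 A
    obtain ⟨Y, rfl⟩ := hκC.obj_bij.2 B
    constructor
    · intro hf
      let I := toNGH hC hD iG (κC.obj X) (κC.obj Y)
      have hI : Isometry I := by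
        apply AddMonoidHomClass.isometry_of_norm
        intro x
        exact le_antisymm (nrm_map_le hC.1 iG _) (hiso _ _ _)
      have hcl : IsClosed (Set.range I) := hI.isClosedEmbedding.isClosed_range
      have hmem : ∀ f' : HomSp DGc hD (iG.obj (κC.obj X)) (iG.obj (κC.obj Y)),
          pG.map (X := iG.obj (κC.obj X)) (Y := iG.obj (κC.obj Y)) f' = 0 → f' ∈ Set.range I := by
        intro f' hf'
        refine hcl.closure_subset (Metric.mem_closure_iff.2 ?_)
        intro ε hε
        obtain ⟨c, hc⟩ := hker X Y f' hf' ε hε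
        refine ⟨iG.map (κC.map c), ⟨κC.map c, rfl⟩, ?_⟩
        exact (dist_eq_norm _ _).trans_lt hc
      obtain ⟨g, hg⟩ := hmem f hf
      exact ⟨g, hg⟩
    · rintro ⟨g, rfl⟩
      apply eq_zero_of_nrm hQ
      apply le_antisymm _ (QGc.nrm_nonneg _)
      apply le_of_forall_pos_le_add
      intro ε hε
      obtain ⟨c, hc⟩ := dense_nrm hκC g ε hε
      have e1 := nrm_map_le hD.1 pG (iG.map (g - κC.map c))
      have e2 := nrm_map_le hC.1 iG (g - κC.map c)
      rw [map_sub, map_sub, hzero, sub_zero, ← map_sub] at e1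
      linarith
end StarCatNu

open scoped ENNReal InnerProductSpace
set_option linter.unusedVariables false
set_option linter.unusedSectionVars false

namespace StarCatNu

theorem map_sum {C D : StarCatNu} (F : StarFunctor C D) {X Y : C.Obj} {ι : Type} (s : Finset ι)
    (f : ι → C.Hom X Y) : F.map (s.sum f) = s.sum fun k => F.map (f k) :=
  _root_.map_sum (AddMonoidHom.mk' (fun f : C.Hom X Y => F.map f) (F.map_add X Y)) f s

section crossed
variable {G : Type} [Group G]

theorem ins_zero {C CG : StarCatNu} {α : GAction G C} (hC : IsCrossedProductAlg G C α CG) (g : G)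
    {X Y : C.Obj} : hC.ins g (0 : C.Hom X (α.actObj g⁻¹ Y)) = 0 :=
  (AddMonoidHom.mk' (fun f : C.Hom X (α.actObj g⁻¹ Y) => hC.ins g f) (hC.ins_add g X Y)).map_zero

theorem gen_ind {C CG : StarCatNu} {α : GAction G C} (hC : IsCrossedProductAlg G C α CG)
    {X Y : C.Obj} (P : CG.Hom (hC.obj X) (hC.obj Y) → Prop) (h0 : P 0)
    (hadd : ∀ u v, P u → P v → P (u + v))
    (hg : ∀ g (f : C.Hom X (α.actObj g⁻¹ Y)), P (hC.ins g f)) (u) : P u := by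
  obtain ⟨s, φ, rfl⟩ := hC.span X Y u
  exact Finset.sum_induction _ P (fun a b => hadd a b) h0 (fun g _ => hg g _)

open Classical in
/-- The linear map from the direct sum to the morphism space of the crossed product. -/
def insLin {C CG : StarCatNu} {α : GAction G C} (hC : IsCrossedProductAlg G C α CG)
    (X Y : C.Obj) : (Π₀ g : G, C.Hom X (α.actObj g⁻¹ Y)) →ₗ[ℂ] CG.Hom (hC.obj X) (hC.obj Y) :=
  DFinsupp.lsum ℂ (fun g =>
    { toFun := fun f => hC.ins g f
      map_add' := hC.ins_add g X Y
      map_smul' := hC.ins_smul g X Y })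

open Classical in
theorem insLin_single {C CG : StarCatNu} {α : GAction G C} (hC : IsCrossedProductAlg G C α CG)
    (X Y : C.Obj) (g : G) (f : C.Hom X (α.actObj g⁻¹ Y)) :
    insLin hC X Y (DFinsupp.single g f) = hC.ins g f := by
  simp [insLin]

open Classical in
theorem insLin_apply {C CG : StarCatNu} {α : GAction G C} (hC : IsCrossedProductAlg G C α CG)
    (X Y : C.Obj) (a : Π₀ g : G, C.Hom X (α.actObj g⁻¹ Y)) :
    insLin hC X Y a = a.support.sum fun g => hC.ins g (a g) := by
  conv_lhs => rw [← DFinsupp.sum_single (f := a)]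
  rw [DFinsupp.sum, _root_.map_sum]
  exact Finset.sum_congr rfl fun g _ => insLin_single hC X Y g _

theorem insLin_bij {C CG : StarCatNu} {α : GAction G C} (hC : IsCrossedProductAlg G C α CG)
    (X Y : C.Obj) : Function.Bijective (insLin hC X Y) := by
  classical
  constructor
  · rw [injective_iff_map_eq_zero]
    intro a ha
    rw [insLin_apply] at ha
    have := hC.indep X Y _ _ ha
    ext g
    by_cases hg : g ∈ a.support
    · exact this g hg
    · exact DFinsupp.notMem_support_iff.1 hg
  · intro u
    refine gen_ind hC (fun u => ∃ a, insLin hC X Y a = u) ⟨0, _root_.map_zero _⟩ ?_ ?_ u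
    · rintro _ _ ⟨a, rfl⟩ ⟨b, rfl⟩
      exact ⟨a + b, _root_.map_add _ _ _⟩
    · intro g f
      exact ⟨_, insLin_single hC X Y g f⟩

/-- Linear extension from generators. -/
theorem lin_ext {C CG : StarCatNu} {α : GAction G C} (hC : IsCrossedProductAlg G C α CG)
    (X Y : C.Obj) {V : Type} [AddCommGroup V] [Module ℂ V]
    (t : ∀ g, C.Hom X (α.actObj g⁻¹ Y) →ₗ[ℂ] V) :
    ∃ m : CG.Hom (hC.obj X) (hC.obj Y) →ₗ[ℂ] V, ∀ g f, m (hC.ins g f) = t g f := by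
  classical
  let e := LinearEquiv.ofBijective (insLin hC X Y) (insLin_bij hC X Y)
  refine ⟨(DFinsupp.lsum ℂ t).comp e.symm.toLinearMap, fun g f => ?_⟩
  have : e.symm (hC.ins g f) = DFinsupp.single g f := by
    rw [LinearEquiv.symm_apply_eq]
    exact (insLin_single hC X Y g f).symm
  rw [LinearMap.comp_apply]
  erw [this]
  simp

theorem exists_crossed {C D CG DG : StarCatNu} {α : GAction G C} {β : GAction G D}
    {F : StarFunctor C D} (hF : EquivariantMap α β F)
    (hC : IsCrossedProductAlg G C α CG) (hD : IsCrossedProductAlg G D β DG) :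
    ∃ ψ : StarFunctor CG DG, IsCrossedMap α β F hF hC hD ψ := by
  have key := fun X Y => lin_ext hC X Y (V := DG.Hom (hD.obj (F.obj X)) (hD.obj (F.obj Y)))
    (fun g =>
      { toFun := fun f => hD.ins g (D.castHom rfl (hF.obj_comm g⁻¹ Y) (F.map f))
        map_add' := fun f f' => by rw [F.map_add, castHom_add, hD.ins_add]
        map_smul' := fun c f => by rw [F.map_smul, castHom_smul, hD.ins_smul]; rfl })
  choose m hm using key
  replace hm : ∀ X Y g (f : C.Hom X (α.actObj g⁻¹ Y)), m X Y (hC.ins g f)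
    = hD.ins g (D.castHom rfl (hF.obj_comm g⁻¹ Y) (F.map f)) := hm
  have hcomp : ∀ X Y Z (v : CG.Hom (hC.obj Y) (hC.obj Z)) (u : CG.Hom (hC.obj X) (hC.obj Y)),
      m X Z (CG.comp v u) = DG.comp (m Y Z v) (m X Y u) := by
    intro X Y Z v u
    refine gen_ind hC (fun v => m X Z (CG.comp v u) = DG.comp (m Y Z v) (m X Y u)) ?_ ?_ ?_ v
    · rw [CG.zero_comp, _root_.map_zero, _root_.map_zero, DG.zero_comp]
    · intro a b ha hb
      rw [CG.add_comp, _root_.map_add, _root_.map_add, DG.add_comp, ha, hb]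
    intro g' f'
    refine gen_ind hC (fun u => m X Z (CG.comp (hC.ins g' f') u)
      = DG.comp (m Y Z (hC.ins g' f')) (m X Y u)) ?_ ?_ ?_ u
    · rw [CG.comp_zero, _root_.map_zero, _root_.map_zero, DG.comp_zero]
    · intro a b ha hb
      rw [CG.comp_add, _root_.map_add, _root_.map_add, DG.comp_add, ha, hb]
    intro g f
    rw [hC.ins_comp, hm, hm, hm, hD.ins_comp]
    congr 1
    have e1 : β.actMap g⁻¹ (D.castHom rfl (hF.obj_comm g'⁻¹ Z) (F.map f'))
        = D.castHom rfl (congrArg (β.actObj g⁻¹) (hF.obj_comm g'⁻¹ Z))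
          (β.actMap g⁻¹ (F.map f')) := map_castHom (β.functor g⁻¹) _ _ _
    rw [e1, ← hF.map_comm, map_castHom, F.map_comp, castHom_castHom, castHom_castHom,
      castHom_comp rfl (hF.obj_comm g⁻¹ Y) _ (F.map (α.actMap g⁻¹ f')) (F.map f),
      castHom_comp rfl rfl, castHom_castHom]
    rfl
  have hstar : ∀ X Y (u : CG.Hom (hC.obj X) (hC.obj Y)),
      m Y X (CG.star u) = DG.star (m X Y u) := by
    intro X Y u
    refine gen_ind hC (fun u => m Y X (CG.star u) = DG.star (m X Y u)) ?_ ?_ ?_ u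
    · rw [CG.star_zero', _root_.map_zero, _root_.map_zero, DG.star_zero']
    · intro a b ha hb
      rw [CG.star_add, _root_.map_add, _root_.map_add, DG.star_add, ha, hb]
    intro g f
    rw [hC.ins_star, hm, hm, hD.ins_star]
    congr 1
    rw [← castHom_star, map_castHom, castHom_castHom, ← F.map_star]
    have e1 : β.actMap g (D.castHom (hF.obj_comm g⁻¹ Y) rfl (F.map (C.star f)))
        = D.castHom (congrArg (β.actObj g) (hF.obj_comm g⁻¹ Y)) rfl
          (β.actMap g (F.map (C.star f))) := map_castHom (β.functor g) _ _ _
    rw [e1, ← hF.map_comm, castHom_castHom, castHom_castHom]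
  obtain ⟨ψ, ho, hψ⟩ := extend CG hC.obj hC.obj_bij
    (pullFunctor CG hC.obj (fun X => hD.obj (F.obj X)) (fun X Y u => m X Y u)
      (fun X Y f f' => _root_.map_add _ _ _) (fun X Y c f => _root_.map_smul _ _ _)
      hcomp hstar)
  exact ⟨ψ, ho, fun g X Y f => (hψ X Y _).trans (hm X Y g f)⟩

theorem cross_sum {C D CG DG : StarCatNu} {α : GAction G C} {β : GAction G D}
    {F : StarFunctor C D} {hF : EquivariantMap α β F}
    {hC : IsCrossedProductAlg G C α CG} {hD : IsCrossedProductAlg G D β DG}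
    {ψ : StarFunctor CG DG} (hψ : IsCrossedMap α β F hF hC hD ψ) {X Y : C.Obj} (s : Finset G)
    (φ : ∀ g, C.Hom X (α.actObj g⁻¹ Y)) :
    DG.castHom (hψ.obj_eq X) (hψ.obj_eq Y) (ψ.map (s.sum fun g => hC.ins g (φ g)))
      = s.sum fun g => hD.ins g (D.castHom rfl (hF.obj_comm g⁻¹ Y) (F.map (φ g))) := by
  rw [map_sum, castHom_sum]
  exact Finset.sum_congr rfl fun g _ => hψ.map_eq g X Y _

theorem crossed_obj_bij {C D CG DG : StarCatNu} {α : GAction G C} {β : GAction G D}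
    {F : StarFunctor C D} {hF : EquivariantMap α β F}
    {hC : IsCrossedProductAlg G C α CG} {hD : IsCrossedProductAlg G D β DG}
    {ψ : StarFunctor CG DG} (hψ : IsCrossedMap α β F hF hC hD ψ) (h : Function.Bijective F.obj) :
    Function.Bijective ψ.obj := by
  have : ψ.obj ∘ hC.obj = hD.obj ∘ F.obj := funext hψ.obj_eq
  refine (Function.Bijective.of_comp_iff _ hC.obj_bij).1 ?_
  rw [this]
  exact hD.obj_bij.comp h

/-- If `ψ u = 0`, then the coefficients are killed by `F`. -/
theorem crossed_zero {C D CG DG : StarCatNu} {α : GAction G C} {β : GAction G D}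
    {F : StarFunctor C D} {hF : EquivariantMap α β F}
    {hC : IsCrossedProductAlg G C α CG} {hD : IsCrossedProductAlg G D β DG}
    {ψ : StarFunctor CG DG} (hψ : IsCrossedMap α β F hF hC hD ψ) {X Y : C.Obj} (s : Finset G)
    (φ : ∀ g, C.Hom X (α.actObj g⁻¹ Y)) (h : ψ.map (s.sum fun g => hC.ins g (φ g)) = 0) :
    ∀ g ∈ s, F.map (φ g) = 0 := by
  intro g hg
  have h2 := cross_sum hψ s φ
  rw [h, castHom_zero] at h2
  exact castHom_eq_zero _ _ (hD.indep _ _ s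
    (fun g => D.castHom rfl (hF.obj_comm g⁻¹ Y) (F.map (φ g))) h2.symm g hg)

theorem part1 {C D Q : StarCatNu} {α : GAction G C} {β : GAction G D} {γ : GAction G Q}
    {i : StarFunctor C D} {p : StarFunctor D Q}
    {hi : EquivariantMap α β i} {hp : EquivariantMap β γ p}
    (hex : IsExactSeq i p) {CG DG QG : StarCatNu} {hC : IsCrossedProductAlg G C α CG}
    {hD : IsCrossedProductAlg G D β DG} {hQ : IsCrossedProductAlg G Q γ QG}
    {iG : StarFunctor CG DG} {pG : StarFunctor DG QG}
    (hiG : IsCrossedMap α β i hi hC hD iG) (hpG : IsCrossedMap β γ p hp hD hQ pG) :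
    IsExactSeq iG pG := by
  refine ⟨crossed_obj_bij hiG hex.i_obj_bij, ?_, ⟨crossed_obj_bij hpG hex.p_quot.1, ?_⟩, ?_⟩
  · intro A B f f' hff
    obtain ⟨X, rfl⟩ := hC.obj_bij.2 A
    obtain ⟨Y, rfl⟩ := hC.obj_bij.2 B
    have hff' : iG.map f = iG.map f' := hff
    apply sub_eq_zero.1
    have h0 : iG.map (f - f') = 0 := by rw [map_sub, hff', sub_self]
    obtain ⟨s, φ, hs⟩ := hC.span X Y (f - f')
    rw [hs] at h0
    rw [hs]
    refine Finset.sum_eq_zero fun g hg => ?_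
    have h1 := crossed_zero hiG s φ h0 g hg
    have h2 : φ g = 0 := hex.i_map_inj _ _ (by
      show i.map (φ g) = i.map 0
      rw [h1, i.map_zero])
    rw [h2, ins_zero]
  · intro A B
    obtain ⟨X, rfl⟩ := hD.obj_bij.2 A
    obtain ⟨Y, rfl⟩ := hD.obj_bij.2 B
    have aux : ∀ u : QG.Hom (hQ.obj (p.obj X)) (hQ.obj (p.obj Y)),
        ∃ d, QG.castHom (hpG.obj_eq X) (hpG.obj_eq Y) (pG.map d) = u := by
      intro u
      refine gen_ind hQ (fun u => ∃ d, QG.castHom (hpG.obj_eq X) (hpG.obj_eq Y) (pG.map d) = u)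
        ⟨0, by rw [pG.map_zero, castHom_zero]⟩ ?_ ?_ u
      · rintro _ _ ⟨a, rfl⟩ ⟨b, rfl⟩
        exact ⟨a + b, by rw [pG.map_add, castHom_add]⟩
      · intro g q
        obtain ⟨q', rfl⟩ := castHom_surj rfl (hp.obj_comm g⁻¹ Y) q
        obtain ⟨d, hd⟩ := hex.p_quot.2 _ _ q'
        have hd' : p.map d = q' := hd
        exact ⟨hD.ins g d, by rw [hpG.map_eq, hd']⟩
    intro v
    obtain ⟨d, hd⟩ := aux (QG.castHom (hpG.obj_eq X) (hpG.obj_eq Y) v)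
    exact ⟨d, castHom_inj _ _ hd⟩
  · intro A B f
    obtain ⟨X, rfl⟩ := hC.obj_bij.2 A
    obtain ⟨Y, rfl⟩ := hC.obj_bij.2 B
    constructor
    · intro hf
      obtain ⟨s, φ, hs⟩ := hD.span _ _ (DG.castHom (hiG.obj_eq X) (hiG.obj_eq Y) f)
      have h0 : pG.map (s.sum fun g => hD.ins g (φ g)) = 0 := by
        rw [← hs, map_castHom, hf, castHom_zero]
      have h1 := crossed_zero hpG s φ h0
      have h2 : ∀ g, ∃ c : C.Hom X (α.actObj g⁻¹ Y), g ∈ s →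
          D.castHom rfl (hi.obj_comm g⁻¹ Y) (i.map c) = φ g := by
        intro g
        by_cases hg : g ∈ s
        · obtain ⟨d, hd⟩ := castHom_surj rfl (hi.obj_comm g⁻¹ Y) (φ g)
          have h3 := h1 g hg
          rw [← hd, map_castHom] at h3
          obtain ⟨c, hc⟩ := (hex.exact _ _ d).1 (castHom_eq_zero _ _ h3)
          exact ⟨c, fun _ => by rw [hc, hd]⟩
        · exact ⟨0, fun h => absurd h hg⟩
      choose c hc using h2
      refine ⟨s.sum fun g => hC.ins g (c g), castHom_inj (hiG.obj_eq X) (hiG.obj_eq Y) ?_⟩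
      rw [cross_sum hiG, hs]
      exact Finset.sum_congr rfl fun g hg => by rw [hc g hg]
    · rintro ⟨u, rfl⟩
      refine gen_ind hC (fun u => pG.map (iG.map u) = 0) ?_ ?_ ?_ u
      · rw [iG.map_zero, pG.map_zero]
      · intro a b ha hb
        rw [iG.map_add, pG.map_add, ha, hb, add_zero]
      · intro g c
        apply castHom_eq_zero (congrArg pG.obj (hiG.obj_eq X)) (congrArg pG.obj (hiG.obj_eq Y))
        rw [← map_castHom pG (hiG.obj_eq X) (hiG.obj_eq Y), hiG.map_eq]
        apply castHom_eq_zero (hpG.obj_eq _) (hpG.obj_eq _)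
        rw [hpG.map_eq, map_castHom, (hex.exact _ _ (i.map c)).2 ⟨c, rfl⟩, castHom_zero,
          castHom_zero, ins_zero]

theorem crossed_comm {C D CG DG CGc DGc : StarCatNu} {α : GAction G C} {β : GAction G D}
    {F : StarFunctor C D} {hF : EquivariantMap α β F}
    {hC : IsCrossedProductAlg G C α CG} {hD : IsCrossedProductAlg G D β DG}
    {κC : StarFunctor CG CGc} {κD : StarFunctor DG DGc} {Ψ : StarFunctor CGc DGc}
    {ψ : StarFunctor CG DG} (hψ : IsCrossedMap α β F hF hC hD ψ)
    (hΨ : IsCrossedMapC α β F hF hC hD κC κD Ψ) : κC.comp Ψ = ψ.comp κD := by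
  have ho : ∀ A, Ψ.obj (κC.obj A) = κD.obj (ψ.obj A) := by
    intro A
    obtain ⟨X, rfl⟩ := hC.obj_bij.2 A
    rw [hΨ.obj_eq, hψ.obj_eq]
  have hm : ∀ A B (u : CG.Hom A B),
      DGc.castHom (ho A) (ho B) (Ψ.map (κC.map u)) = κD.map (ψ.map u) := by
    intro A B
    obtain ⟨X, rfl⟩ := hC.obj_bij.2 A
    obtain ⟨Y, rfl⟩ := hC.obj_bij.2 B
    intro u
    refine gen_ind hC (fun u => DGc.castHom (ho _) (ho _) (Ψ.map (κC.map u)) = κD.map (ψ.map u))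
      ?_ ?_ ?_ u
    · rw [κC.map_zero, Ψ.map_zero, castHom_zero, ψ.map_zero, κD.map_zero]
    · intro a b ha hb
      rw [κC.map_add, Ψ.map_add, castHom_add, ψ.map_add, κD.map_add, ha, hb]
    · intro g f
      apply castHom_inj (congrArg κD.obj (hψ.obj_eq X)) (congrArg κD.obj (hψ.obj_eq Y))
      rw [← map_castHom κD (hψ.obj_eq X) (hψ.obj_eq Y), hψ.map_eq, castHom_castHom, hΨ.map_eq]
  exact functor_ext _ _ ho hm

/-- Inclusion of `D` into the crossed product at the neutral element. -/
def ins1 {D DG : StarCatNu} {β : GAction G D} (hD : IsCrossedProductAlg G D β DG) {X Y : D.Obj}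
    (f : D.Hom X Y) : DG.Hom (hD.obj X) (hD.obj Y) :=
  hD.ins 1 (D.castHom rfl (β.one_inv_obj Y).symm f)

theorem ins_congr {D DG : StarCatNu} {β : GAction G D} (hD : IsCrossedProductAlg G D β DG)
    {X Y : D.Obj} {g g' : G} (h : g = g') (f : D.Hom X (β.actObj g⁻¹ Y))
    (f' : D.Hom X (β.actObj g'⁻¹ Y))
    (hf : D.castHom rfl (by rw [h]) f = f') : hD.ins g f = hD.ins g' f' := by
  subst h
  rw [← hf]; rfl

theorem act_one {D : StarCatNu} (β : GAction G D) {X Y : D.Obj} {g : G} (hg : g = 1)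
    (hX : β.actObj g X = X) (hY : β.actObj g Y = Y)
    (f : D.Hom X Y) : D.castHom hX hY (β.actMap g f) = f := by
  subst hg
  exact β.one_map X Y f

theorem act_act {D : StarCatNu} (β : GAction G D) {X Y : D.Obj} {g h : G} (hg : g * h = 1)
    (hX : β.actObj g (β.actObj h X) = X) (hY : β.actObj g (β.actObj h Y) = Y)
    (f : D.Hom X Y) : D.castHom hX hY (β.actMap g (β.actMap h f)) = f := by
  have h1 := β.mul_map g h X Y f
  have hX' : β.actObj (g * h) X = X := by rw [hg, β.one_obj]
  have hY' : β.actObj (g * h) Y = Y := by rw [hg, β.one_obj]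
  have h2 := act_one β hg hX' hY' f
  rw [← h1, castHom_castHom] at h2
  exact h2

theorem ins_comp_ins1 {D DG : StarCatNu} {β : GAction G D} (hD : IsCrossedProductAlg G D β DG)
    {X Y Z : D.Obj} (g : G) (f' : D.Hom Y (β.actObj g⁻¹ Z)) (f : D.Hom X Y) :
    DG.comp (hD.ins g f') (ins1 hD f) = hD.ins g (D.comp f' f) := by
  rw [ins1, hD.ins_comp]
  apply ins_congr hD (mul_one g)
  rw [castHom_castHom, castHom_comp rfl (β.one_inv_obj Y) _ (β.actMap 1⁻¹ f'), castHom_castHom,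
    act_one β inv_one]
  rfl

theorem ins1_comp_ins1 {D DG : StarCatNu} {β : GAction G D} (hD : IsCrossedProductAlg G D β DG)
    {X Y Z : D.Obj} (f' : D.Hom Y Z) (f : D.Hom X Y) :
    DG.comp (ins1 hD f') (ins1 hD f) = ins1 hD (D.comp f' f) := by
  conv_lhs => rw [ins1]
  rw [ins_comp_ins1, ins1, castHom_comp rfl rfl]
  rfl

theorem ins1_star {D DG : StarCatNu} {β : GAction G D} (hD : IsCrossedProductAlg G D β DG)
    {X Y : D.Obj} (f : D.Hom X Y) : DG.star (ins1 hD f) = ins1 hD (D.star f) := by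
  rw [ins1, hD.ins_star, ins1]
  apply ins_congr hD inv_one
  rw [castHom_castHom, ← castHom_star]
  have e1 : β.actMap 1 (D.castHom (β.one_inv_obj Y).symm rfl (D.star f))
      = D.castHom (congrArg (β.actObj 1) (β.one_inv_obj Y).symm) rfl
        (β.actMap 1 (D.star f)) := map_castHom (β.functor 1) _ _ _
  rw [e1, castHom_castHom, castHom_eq_iff, castHom_castHom,
    ← castHom_eq_iff (β.one_obj _) (β.one_obj _)]
  exact β.one_map _ _ _

theorem ins_star_ins {D DG : StarCatNu} {β : GAction G D} (hD : IsCrossedProductAlg G D β DG)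
    {X Y : D.Obj} (g : G) (f : D.Hom X (β.actObj g⁻¹ Y)) :
    DG.comp (DG.star (hD.ins g f)) (hD.ins g f) = ins1 hD (D.comp (D.star f) f) := by
  rw [hD.ins_star, hD.ins_comp, ins1]
  apply ins_congr hD (inv_mul_cancel g)
  have e1 : β.actMap g⁻¹ (D.castHom (β.cancel_obj g Y) (β.inv_inv_obj g X).symm
        (β.actMap g (D.star f)))
      = D.castHom (congrArg (β.actObj g⁻¹) (β.cancel_obj g Y))
        (congrArg (β.actObj g⁻¹) (β.inv_inv_obj g X).symm)
        (β.actMap g⁻¹ (β.actMap g (D.star f))) := map_castHom (β.functor g⁻¹) _ _ _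
  rw [e1, castHom_castHom, castHom_comp rfl rfl, castHom_castHom, castHom_comp rfl rfl]
  have hX : β.actObj g⁻¹ (β.actObj g X) = X := by rw [β.mul_obj, inv_mul_cancel, β.one_obj]
  have h1 := act_act β (inv_mul_cancel g) (congrArg (β.actObj g⁻¹) (β.cancel_obj g Y)) hX (D.star f)
  conv_rhs => rw [← h1]
  rw [castHom_castHom]

theorem ins1_add {D DG : StarCatNu} {β : GAction G D} (hD : IsCrossedProductAlg G D β DG)
    {X Y : D.Obj} (f f' : D.Hom X Y) : ins1 hD (f + f') = ins1 hD f + ins1 hD f' := by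
  rw [ins1, castHom_add, hD.ins_add]; rfl

theorem ins1_smul {D DG : StarCatNu} {β : GAction G D} (hD : IsCrossedProductAlg G D β DG)
    {X Y : D.Obj} (c : ℂ) (f : D.Hom X Y) : ins1 hD (c • f) = c • ins1 hD f := by
  rw [ins1, castHom_smul, hD.ins_smul]; rfl

theorem ident_star {D : StarCatNu} {X : D.Obj} {e : D.Hom X X} (he : IsIdentityAt D e) :
    D.star e = e := by
  calc D.star e = D.comp (D.star e) e := (he.1 _ _).symm
    _ = D.star (D.comp (D.star e) e) := by rw [D.star_comp, D.star_star]
    _ = e := by rw [he.1, D.star_star]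

theorem ins1_ident {D DG : StarCatNu} {β : GAction G D} (hD : IsCrossedProductAlg G D β DG)
    {X : D.Obj} {e : D.Hom X X} (he : IsIdentityAt D e) : IsIdentityAt DG (ins1 hD e) := by
  have hr : ∀ (B : DG.Obj) (f : DG.Hom (hD.obj X) B), DG.comp f (ins1 hD e) = f := by
    intro B
    obtain ⟨Y, rfl⟩ := hD.obj_bij.2 B
    intro u
    refine gen_ind hD (fun u => DG.comp u (ins1 hD e) = u) (DG.zero_comp _) ?_ ?_ u
    · intro a b ha hb
      rw [DG.add_comp, ha, hb]
    · intro g f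
      rw [ins_comp_ins1, he.1]
  refine ⟨hr, fun B u => ?_⟩
  have := congrArg (fun z => DG.star z) (hr B (DG.star u))
  simpa only [DG.star_comp, DG.star_star, ins1_star, ident_star he] using this

theorem part2 {C D Q : StarCatNu} (hDs : IsCStar D) (hDu : D.IsUnital)
    {α : GAction G C} {β : GAction G D} {γ : GAction G Q}
    {i : StarFunctor C D} {p : StarFunctor D Q}
    {hi : EquivariantMap α β i} {hp : EquivariantMap β γ p}
    (hex : IsExactSeq i p) {CG DG QG CGc DGc QGc : StarCatNu}
    {hC : IsCrossedProductAlg G C α CG}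
    {hD : IsCrossedProductAlg G D β DG} {hQ : IsCrossedProductAlg G Q γ QG}
    {κC : StarFunctor CG CGc} {κD : StarFunctor DG DGc} {κQ : StarFunctor QG QGc}
    (hκC : IsCompletion CG CGc κC) (hκD : IsCompletion DG DGc κD) (hκQ : IsCompletion QG QGc κQ)
    {iG : StarFunctor CGc DGc} {pG : StarFunctor DGc QGc}
    (hiG : IsCrossedMapC α β i hi hC hD κC κD iG)
    (hpG : IsCrossedMapC β γ p hp hD hQ κD κQ pG) :
    IsExactSeq iG pG := by
  obtain ⟨j, hj⟩ := exists_crossed hi hC hD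
  obtain ⟨pa, hpa⟩ := exists_crossed hp hD hQ
  refine main2 j pa (part1 hex hj hpa) κC κD κQ hκC hκD hκQ iG pG (crossed_comm hj hiG)
    (crossed_comm hpa hpG) ?_ ?_
  · intro A
    obtain ⟨X, rfl⟩ := hD.obj_bij.2 A
    obtain ⟨e, he⟩ := hDu X
    exact ⟨_, ins1_ident hD he⟩
  · intro A B
    obtain ⟨X, rfl⟩ := hD.obj_bij.2 A
    obtain ⟨Y, rfl⟩ := hD.obj_bij.2 B
    intro P h0 hadd hP u
    refine gen_ind hD P h0 hadd ?_ u
    intro g d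
    apply hP
    obtain ⟨e, he⟩ := hDu X
    obtain ⟨r, hr⟩ := exists_sq D hDs X e he _ d
    refine ⟨D.nrm d * D.nrm d, mul_self_nonneg _, ins1 hD r, ?_⟩
    intro W x
    rw [← DG.comp_assoc, ← DG.comp_assoc, ← DG.add_comp, ins_star_ins, ins1_star, ins1_comp_ins1,
      ← ins1_add, hr, ins1_smul, DG.smul_comp, (ins1_ident hD he).2]

end crossed
end StarCatNu

/-- (1) If `0 → C → D → Q → 0` is an exact sequence in `Fun(BG, ∗Cat^nu_ℂ)`, then
`0 → C ⋊^alg G → D ⋊^alg G → Q ⋊^alg G → 0` is an exact sequence in `∗Cat^nu_ℂ`.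
(2) If `0 → C → D → Q → 0` is an exact sequence of C*-categories in
`Fun(BG, C*Cat^nu)` such that `D` is unital, then `0 → C ⋊ G → D ⋊ G → Q ⋊ G → 0` is an
exact sequence of C*-categories. -/
theorem crossed_product_preserves_exact_sequences
    (G : Type) [Group G] :
    -- (1) the algebraic case
    (∀ (C D Q : StarCatNu) (α : GAction G C) (β : GAction G D) (γ : GAction G Q)
      (i : StarFunctor C D) (p : StarFunctor D Q)
      (hi : EquivariantMap α β i) (hp : EquivariantMap β γ p),
      IsExactSeq i p →
      ∀ (CG DG QG : StarCatNu) (hC : IsCrossedProductAlg G C α CG)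
        (hD : IsCrossedProductAlg G D β DG) (hQ : IsCrossedProductAlg G Q γ QG)
        (iG : StarFunctor CG DG) (pG : StarFunctor DG QG),
        IsCrossedMap α β i hi hC hD iG → IsCrossedMap β γ p hp hD hQ pG →
        IsExactSeq iG pG) ∧
    -- (2) the C*-categorical case
    (∀ (C D Q : StarCatNu), IsCStar C → IsCStar D → IsCStar Q → D.IsUnital →
      ∀ (α : GAction G C) (β : GAction G D) (γ : GAction G Q)
        (i : StarFunctor C D) (p : StarFunctor D Q)
        (hi : EquivariantMap α β i) (hp : EquivariantMap β γ p),
      IsExactSeq i p →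
      ∀ (CG DG QG CGc DGc QGc : StarCatNu)
        (hC : IsCrossedProductAlg G C α CG) (hD : IsCrossedProductAlg G D β DG)
        (hQ : IsCrossedProductAlg G Q γ QG)
        (κC : StarFunctor CG CGc) (κD : StarFunctor DG DGc) (κQ : StarFunctor QG QGc),
        IsCompletion CG CGc κC → IsCompletion DG DGc κD → IsCompletion QG QGc κQ →
      ∀ (iG : StarFunctor CGc DGc) (pG : StarFunctor DGc QGc),
        IsCrossedMapC α β i hi hC hD κC κD iG →
        IsCrossedMapC β γ p hp hD hQ κD κQ pG →
        IsExactSeq iG pG) := by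
  refine ⟨?_, ?_⟩
  · intro C D Q α β γ i p hi hp hex CG DG QG hC hD hQ iG pG hiG hpG
    exact StarCatNu.part1 hex hiG hpG
  · intro C D Q _ hDs _ hDu α β γ i p hi hp hex CG DG QG CGc DGc QGc hC hD hQ κC κD κQ
      hκC hκD hκQ iG pG hiG hpG
    exact StarCatNu.part2 hDs hDu hex hκC hκD hκQ hiG hpG
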